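/- (Corollary 1.4 for X = S¹.) Let Γ be a cocompact Fuchsian group, let X₀ be the set of harmonic functions h : 𝔻 → ℝ with |h(z)| ≤ 1 for all z ∈ 𝔻, equipped with the topology of uniform convergence on compact subsets of 𝔻, and let Γ act on X₀ by γ·h = h ∘ γ⁻¹. Let Γ act on the circle S¹ by homeomorphisms. Then every continuous Γ-equivariant map F : S¹ → X₀ (i.e., F(γ·x) = γ·F(x) for all γ ∈ Γ and x ∈ S¹) takes values in the set of constant functions: for every x ∈ S¹ the harmonic function F(x) is constant on 𝔻. -/

import Mathlib

open Metric Set Filter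

noncomputable section

/-- The open unit disc in `ℂ`. -/
def unitDisc : Set ℂ := Metric.ball 0 1

/-- A function `f : ℂ → ℝ` is harmonic on a set `U ⊆ ℂ` if, locally on `U`, it is
the real part of a holomorphic function (for open `U` this is equivalent to being
`C²` with vanishing Laplacian). -/
def HarmonicOnSet (f : ℂ → ℝ) (U : Set ℂ) : Prop :=
  ∀ z ∈ U, ∃ r > 0, Metric.ball z r ⊆ U ∧
    ∃ g : ℂ → ℂ, DifferentiableOn ℂ g (Metric.ball z r) ∧
      ∀ w ∈ Metric.ball z r, f w = (g w).re

/-- `ρ` is a cocompact Fuchsian group action of `Γ` on the open unit disc: a faithful,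
properly discontinuous, cocompact action by Möbius transformations
`z ↦ (αz+β)/(β̄z+ᾱ)` with `|α|² - |β|² = 1`. -/
structure IsCocompactFuchsian (Γ : Type*) [Group Γ] (ρ : Γ → ℂ → ℂ) : Prop where
  one_act : ∀ z ∈ unitDisc, ρ 1 z = z
  mul_act : ∀ γ₁ γ₂ : Γ, ∀ z ∈ unitDisc, ρ (γ₁ * γ₂) z = ρ γ₁ (ρ γ₂ z)
  maps_disc : ∀ γ : Γ, ∀ z ∈ unitDisc, ρ γ z ∈ unitDisc
  moebius : ∀ γ : Γ, ∃ α β : ℂ, ‖α‖ ^ 2 - ‖β‖ ^ 2 = 1 ∧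
    ∀ z ∈ unitDisc, ρ γ z = (α * z + β) / ((starRingEnd ℂ) β * z + (starRingEnd ℂ) α)
  faithful : ∀ γ : Γ, (∀ z ∈ unitDisc, ρ γ z = z) → γ = 1
  properly_discontinuous : ∀ K : Set ℂ, K ⊆ unitDisc → IsCompact K →
    {γ : Γ | ((ρ γ '' K) ∩ K).Nonempty}.Finite
  cocompact : ∃ K : Set ℂ, K ⊆ unitDisc ∧ IsCompact K ∧ ∀ z ∈ unitDisc, ∃ γ : Γ, ρ γ z ∈ K

/-- `σ` is an action of the group `Γ` on the topological space `X` by homeomorphisms. -/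
structure IsActionByHomeomorphisms (Γ : Type*) [Group Γ] (X : Type*) [TopologicalSpace X]
    (σ : Γ → X → X) : Prop where
  one_act : ∀ x : X, σ 1 x = x
  mul_act : ∀ γ₁ γ₂ : Γ, ∀ x : X, σ (γ₁ * γ₂) x = σ γ₁ (σ γ₂ x)
  continuous_act : ∀ γ : Γ, Continuous (σ γ)

/-- The unit circle in `ℂ`, as a topological space. -/
abbrev UnitCircle : Type := ↥(Metric.sphere (0 : ℂ) 1)

/-- A continuous function on the unit disc (as a subtype) is harmonic if, locally, it is
the real part of a holomorphic function. -/
def IsHarmonicDiscFun (h : ↥unitDisc → ℝ) : Prop :=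
  ∀ z : ↥unitDisc, ∃ r > 0, Metric.ball (z : ℂ) r ⊆ unitDisc ∧
    ∃ g : ℂ → ℂ, DifferentiableOn ℂ g (Metric.ball (z : ℂ) r) ∧
      ∀ w : ↥unitDisc, (w : ℂ) ∈ Metric.ball (z : ℂ) r → h w = (g (w : ℂ)).re

/-- The space `X₀` of harmonic functions `h : 𝔻 → ℝ` with `|h| ≤ 1`, realized as a subset of
the space `C(𝔻, ℝ)` of continuous functions with the compact-open topology (which, `𝔻` being
locally compact, is the topology of uniform convergence on compact subsets of `𝔻`). -/
def X₀ : Set C(↥unitDisc, ℝ) :=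
  {h | IsHarmonicDiscFun h ∧ ∀ z : ↥unitDisc, |h z| ≤ 1}

section helpers
open MeasureTheory ENNReal


abbrev DD : Type := ↥unitDisc

instance instMeasureSpaceDD : MeasureSpace DD := Measure.Subtype.measureSpace

lemma DD.norm_lt (z : DD) : ‖(z : ℂ)‖ < 1 := by
  have := z.2
  simpa [unitDisc] using this

lemma mem_unitDisc_iff (z : ℂ) : z ∈ unitDisc ↔ ‖z‖ < 1 := by simp [unitDisc]

lemma isOpen_unitDisc : IsOpen unitDisc := Metric.isOpen_ball

lemma measurableSet_unitDisc : MeasurableSet unitDisc := isOpen_unitDisc.measurableSet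

/-- the denominator of a Moebius map -/
def jden (α β z : ℂ) : ℂ := (starRingEnd ℂ) β * z + (starRingEnd ℂ) α

def mob (α β z : ℂ) : ℂ := (α * z + β) / jden α β z

lemma jden_ne {α β : ℂ} (h : ‖α‖ ^ 2 - ‖β‖ ^ 2 = 1) {z : ℂ} (hz : ‖z‖ < 1) :
    jden α β z ≠ 0 := by
  intro h0
  unfold jden at h0
  have h1 : ‖(starRingEnd ℂ) β * z‖ = ‖(starRingEnd ℂ) α‖ := by
    rw [eq_neg_of_add_eq_zero_left h0, norm_neg]
  rw [norm_mul, RCLike.norm_conj, RCLike.norm_conj] at h1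
  have := norm_nonneg α
  have := norm_nonneg β
  have := norm_nonneg z
  nlinarith [mul_le_mul_of_nonneg_left hz.le (norm_nonneg β)]

lemma alpha_mul_conj {α β : ℂ} (h : ‖α‖ ^ 2 - ‖β‖ ^ 2 = 1) :
    α * (starRingEnd ℂ) α - β * (starRingEnd ℂ) β = 1 := by
  rw [Complex.mul_conj, Complex.mul_conj, Complex.normSq_eq_norm_sq, Complex.normSq_eq_norm_sq]
  exact_mod_cast h

lemma mob_key {α β : ℂ} (h : ‖α‖ ^ 2 - ‖β‖ ^ 2 = 1) {z w : ℂ} (hz : ‖z‖ < 1) (hw : ‖w‖ < 1) :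
    1 - (starRingEnd ℂ) (mob α β z) * mob α β w =
      (1 - (starRingEnd ℂ) z * w) / ((starRingEnd ℂ) (jden α β z) * jden α β w) := by
  have hz' := jden_ne h hz
  have hw' := jden_ne h hw
  have hz'' : (starRingEnd ℂ) (jden α β z) ≠ 0 := by simpa using hz'
  have := alpha_mul_conj h
  unfold mob
  rw [map_div₀, div_mul_div_comm, eq_div_iff (mul_ne_zero hz'' hw'), sub_mul,
    div_mul_cancel₀ _ (mul_ne_zero hz'' hw')]
  unfold jden
  simp only [map_add, map_mul, Complex.conj_conj]
  linear_combination (1 - (starRingEnd ℂ) z * w) * this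

lemma one_sub_conj_ne {z w : ℂ} (hz : ‖z‖ < 1) (hw : ‖w‖ < 1) :
    1 - (starRingEnd ℂ) z * w ≠ 0 := by
  intro h
  have h1 : ‖(starRingEnd ℂ) z * w‖ = 1 := by rw [← sub_eq_zero.mp h]; simp
  rw [norm_mul, RCLike.norm_conj] at h1
  nlinarith [norm_nonneg z, norm_nonneg w]

lemma mob_mem {α β : ℂ} (h : ‖α‖ ^ 2 - ‖β‖ ^ 2 = 1) {z : ℂ} (hz : ‖z‖ < 1) :
    ‖mob α β z‖ < 1 := by
  have := mob_key h hz hz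
  rw [mul_comm ((starRingEnd ℂ) (mob α β z)), mul_comm ((starRingEnd ℂ) z),
    mul_comm ((starRingEnd ℂ) (jden α β z)),
    Complex.mul_conj, Complex.mul_conj, Complex.mul_conj] at this
  have h2 : 1 - Complex.normSq (mob α β z) = (1 - Complex.normSq z) / Complex.normSq (jden α β z) := by
    exact_mod_cast this
  rw [Complex.normSq_eq_norm_sq, Complex.normSq_eq_norm_sq, Complex.normSq_eq_norm_sq] at h2
  have h3 : 0 < (1 - ‖z‖ ^ 2) / ‖jden α β z‖ ^ 2 := by
    have := norm_pos_iff.mpr (jden_ne h hz)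
    have := norm_nonneg z
    apply div_pos _ (by positivity)
    nlinarith
  rw [← h2] at h3
  nlinarith [norm_nonneg (mob α β z)]

lemma mob_inv_cond {α β : ℂ} (h : ‖α‖ ^ 2 - ‖β‖ ^ 2 = 1) :
    ‖(starRingEnd ℂ) α‖ ^ 2 - ‖-β‖ ^ 2 = 1 := by simpa using h

lemma mob_inv_mob {α β : ℂ} (h : ‖α‖ ^ 2 - ‖β‖ ^ 2 = 1) {z : ℂ} (hz : ‖z‖ < 1) :
    mob ((starRingEnd ℂ) α) (-β) (mob α β z) = z := by
  have hz' := jden_ne h hz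
  have h2 := jden_ne (mob_inv_cond h) (mob_mem h hz)
  have := alpha_mul_conj h
  rw [mob, div_eq_iff h2]
  unfold jden mob
  have hz2 : jden α β z ≠ 0 := hz'
  field_simp
  unfold jden
  simp only [map_neg, Complex.conj_conj]
  linear_combination (0:ℂ) * this

lemma mob_mob_inv {α β : ℂ} (h : ‖α‖ ^ 2 - ‖β‖ ^ 2 = 1) {z : ℂ} (hz : ‖z‖ < 1) :
    mob α β (mob ((starRingEnd ℂ) α) (-β) z) = z := by
  have := mob_inv_mob (mob_inv_cond h) hz
  simpa using this

lemma mob_hasDerivAt {α β : ℂ} (h : ‖α‖ ^ 2 - ‖β‖ ^ 2 = 1) {z : ℂ} (hz : ‖z‖ < 1) :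
    HasDerivAt (mob α β) (1 / (jden α β z) ^ 2) z := by
  have hz' := jden_ne h hz
  have := alpha_mul_conj h
  have h1 : HasDerivAt (fun z => α * z + β) α z := by
    simpa using ((hasDerivAt_id' z).const_mul α).add_const β
  have h2 : HasDerivAt (jden α β) ((starRingEnd ℂ) β) z := by
    have := ((hasDerivAt_id' z).const_mul ((starRingEnd ℂ) β)).add_const ((starRingEnd ℂ) α)
    rw [mul_one] at this
    exact this
  have h3 : HasDerivAt (mob α β) _ z := h1.div h2 hz'
  suffices e : 1 / (jden α β z) ^ 2 = (α * jden α β z - (α * z + β) * (starRingEnd ℂ) β) / (jden α β z) ^ 2 from by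
    rw [e]; exact h3
  congr 1
  unfold jden
  linear_combination -this

def mobD (α β : ℂ) (h : ‖α‖ ^ 2 - ‖β‖ ^ 2 = 1) (z : DD) : DD :=
  ⟨mob α β z, (mem_unitDisc_iff _).2 (mob_mem h z.norm_lt)⟩

lemma continuous_mobD (α β : ℂ) (h : ‖α‖ ^ 2 - ‖β‖ ^ 2 = 1) : Continuous (mobD α β h) := by
  refine Continuous.subtype_mk ?_ _
  rw [continuous_iff_continuousAt]
  intro z
  exact (mob_hasDerivAt h z.norm_lt).continuousAt.comp continuous_subtype_val.continuousAt

lemma det_toSpan (c : ℂ) :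
    ((ContinuousLinearMap.toSpanSingleton ℂ c).restrictScalars ℝ).det = ‖c‖ ^ 2 := by
  have h1 : ((ContinuousLinearMap.toSpanSingleton ℂ c : ℂ →L[ℂ] ℂ) : ℂ →ₗ[ℂ] ℂ)
      = c • LinearMap.id := by
    ext; simp
  change LinearMap.det (LinearMap.restrictScalars ℝ
    ((ContinuousLinearMap.toSpanSingleton ℂ c : ℂ →L[ℂ] ℂ) : ℂ →ₗ[ℂ] ℂ)) = _
  rw [LinearMap.det_restrictScalars, h1, LinearMap.det_smul]
  simp [Algebra.norm_complex_eq, Complex.normSq_eq_norm_sq]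

/-- change of variables -/
lemma lintegral_mobD (α β : ℂ) (h : ‖α‖ ^ 2 - ‖β‖ ^ 2 = 1) (f : DD → ℝ≥0∞) :
    ∫⁻ w : DD, ENNReal.ofReal ((‖jden α β w‖ ^ 4)⁻¹) * f (mobD α β h w) = ∫⁻ w : DD, f w := by
  classical
  set g : ℂ → ℝ≥0∞ := fun z => if hz : z ∈ unitDisc then f ⟨z, hz⟩ else 0 with hg
  have e1 : ∀ w : DD, f w = g w := fun w => by simp [hg, w.2]
  have himg : mob α β '' unitDisc = unitDisc := by
    ext z
    constructor
    · rintro ⟨w, hw, rfl⟩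
      exact (mem_unitDisc_iff _).2 (mob_mem h ((mem_unitDisc_iff _).1 hw))
    · intro hz
      have hz' := (mem_unitDisc_iff _).1 hz
      exact ⟨_, (mem_unitDisc_iff _).2 (mob_mem (mob_inv_cond h) hz'), mob_mob_inv h hz'⟩
  have hinj : InjOn (mob α β) unitDisc := by
    intro z hz w hw hzw
    rw [← mob_inv_mob h ((mem_unitDisc_iff _).1 hz), hzw, mob_inv_mob h ((mem_unitDisc_iff _).1 hw)]
  have main := lintegral_image_eq_lintegral_abs_det_fderiv_mul volume measurableSet_unitDisc
    (f := mob α β)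
    (f' := fun z => (ContinuousLinearMap.toSpanSingleton ℂ (1 / (jden α β z) ^ 2)).restrictScalars ℝ)
    (fun z hz => ((mob_hasDerivAt h ((mem_unitDisc_iff _).1 hz)).hasFDerivAt.restrictScalars ℝ).hasFDerivWithinAt)
    hinj g
  rw [himg] at main
  simp_rw [e1]
  change ∫⁻ w : DD, (fun w : ℂ => ENNReal.ofReal ((‖jden α β w‖ ^ 4)⁻¹) * g (mob α β w)) w = _
  have hl := lintegral_subtype_comap measurableSet_unitDisc (μ := (volume : Measure ℂ)) 
    (fun w : ℂ => ENNReal.ofReal ((‖jden α β w‖ ^ 4)⁻¹) * g (mob α β w))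
  have hr := lintegral_subtype_comap measurableSet_unitDisc (μ := (volume : Measure ℂ)) g
  refine hl.trans (Eq.trans ?_ hr.symm)
  rw [main]
  refine lintegral_congr fun w => ?_
  congr 2
  rw [det_toSpan, abs_of_nonneg (by positivity), norm_div, norm_pow, norm_one, one_div, inv_pow,
    ← pow_mul]


lemma IsHarmonicDiscFun.affine {h : DD → ℝ} (hh : IsHarmonicDiscFun h) (c d : ℝ) :
    IsHarmonicDiscFun (fun z => c * h z + d) := by
  intro z
  obtain ⟨r, hr, hsub, g, hg, hgw⟩ := hh z
  refine ⟨r, hr, hsub, fun w => c * g w + d, (hg.const_mul _).add_const _, ?_⟩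
  intro w hw
  simp [hgw w hw]

lemma IsHarmonicDiscFun.comp_mobD {h : DD → ℝ} (hh : IsHarmonicDiscFun h)
    (α β : ℂ) (hab : ‖α‖ ^ 2 - ‖β‖ ^ 2 = 1) :
    IsHarmonicDiscFun (fun z => h (mobD α β hab z)) := by
  intro z
  obtain ⟨r, hr, hsub, g, hg, hgw⟩ := hh (mobD α β hab z)
  have hc : ContinuousAt (mob α β) (z : ℂ) := (mob_hasDerivAt hab (DD.norm_lt z)).continuousAt
  have h1 : ∀ᶠ w in nhds (z : ℂ), mob α β w ∈ ball (mob α β z) r ∧ w ∈ unitDisc :=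
    (hc.eventually (ball_mem_nhds _ hr)).and (isOpen_unitDisc.mem_nhds z.2)
  obtain ⟨ε, hε, hb⟩ := Metric.eventually_nhds_iff_ball.1 h1
  refine ⟨ε, hε, fun w hw => (hb w hw).2, fun w => g (mob α β w), ?_, ?_⟩
  · refine DifferentiableOn.comp hg ?_ (fun w hw => (hb w hw).1)
    intro w hw
    exact (mob_hasDerivAt hab ((mem_unitDisc_iff _).1 (hb w hw).2)).differentiableAt.differentiableWithinAt
  · intro w hw
    exact hgw (mobD α β hab w) (hb w hw).1

/-- extension by zero -/
def ext0 (u : DD → ℝ) (z : ℂ) : ℝ := by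
  classical
  exact if hz : z ∈ unitDisc then u ⟨z, hz⟩ else 0

lemma ext0_coe (u : DD → ℝ) (z : DD) : ext0 u z = u z := by
  simp [ext0]

lemma ext0_mk (u : DD → ℝ) (z : ℂ) (hz : z ∈ unitDisc) : ext0 u z = u ⟨z, hz⟩ := by
  simp [ext0, hz]

lemma ext0_measurable {u : DD → ℝ} (hu : Continuous u) : Measurable (ext0 u) := by
  classical
  unfold ext0
  exact Measurable.dite (f := u) (g := fun _ => (0:ℝ)) hu.measurable measurable_const measurableSet_unitDisc

lemma ext0_harmonic {u : DD → ℝ} (hu : IsHarmonicDiscFun u) :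
    InnerProductSpace.HarmonicOnNhd (ext0 u) unitDisc := by
  intro z hz
  obtain ⟨r, hr, hsub, g, hg, hgw⟩ := hu ⟨z, hz⟩
  have hA : AnalyticAt ℂ g z := hg.analyticAt (ball_mem_nhds _ hr)
  refine (InnerProductSpace.harmonicAt_congr_nhds ?_).2 hA.harmonicAt_re
  filter_upwards [ball_mem_nhds z hr] with w hw
  rw [ext0_mk u w (hsub hw)]
  exact hgw ⟨w, hsub hw⟩ hw

def D0 : DD := ⟨0, by simp [unitDisc]⟩

lemma circle_mean {u : DD → ℝ} (hu : IsHarmonicDiscFun u) (hpos : ∀ z, 0 ≤ u z)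
    {r : ℝ} (hr : 0 < r) (hr1 : r < 1) :
    ∫⁻ θ in Ioo (-Real.pi) Real.pi, ENNReal.ofReal (ext0 u (circleMap 0 r θ)) =
      ENNReal.ofReal (u D0) * ∫⁻ θ in Ioo (-Real.pi) Real.pi, 1 := by
  have hsub : closedBall (0:ℂ) |r| ⊆ unitDisc := by
    rw [abs_of_pos hr]; exact closedBall_subset_ball hr1
  have hH := (ext0_harmonic hu).mono hsub
  have hm := hH.circleAverage_eq
  have hmem : ∀ θ, circleMap 0 r θ ∈ unitDisc := fun θ => by
    simp [mem_unitDisc_iff, abs_of_pos hr, hr1]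
  have hcont : Continuous (fun θ => ext0 u (circleMap 0 r θ)) := by
    refine (ext0_harmonic hu).continuousOn.comp_continuous (continuous_circleMap 0 r) hmem
  have hper : Function.Periodic (fun θ => ext0 u (circleMap 0 r θ)) (2 * Real.pi) := fun θ => by
    simp [periodic_circleMap 0 r θ]
  have hI := hper.intervalIntegral_add_eq (-Real.pi) 0
  rw [Real.circleAverage_def] at hm
  have e0 : ext0 u 0 = u D0 := ext0_mk _ _ _
  rw [e0] at hm
  have hI2 : ∫ θ in (-Real.pi)..Real.pi, ext0 u (circleMap 0 r θ) = 2 * Real.pi * u D0 := by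
    rw [← hm]
    have : -Real.pi + 2 * Real.pi = Real.pi := by ring
    rw [this, zero_add] at hI
    rw [hI, smul_eq_mul, mul_inv_cancel_left₀ (by positivity)]
  rw [intervalIntegral.integral_of_le (by linarith [Real.pi_pos]), integral_Ioc_eq_integral_Ioo] at hI2
  rw [← ofReal_integral_eq_lintegral_ofReal, hI2]
  · simp only [lintegral_const, Measure.restrict_apply MeasurableSet.univ, univ_inter, Real.volume_Ioo, one_mul]
    rw [← ENNReal.ofReal_mul (hpos _)]
    congr 1; ring
  · exact (hcont.integrableOn_Icc (a := -Real.pi) (b := Real.pi)).mono_set Ioo_subset_Icc_self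
  · refine ae_of_all _ fun θ => ?_
    change 0 ≤ ext0 u _
    rw [ext0_mk _ _ (hmem θ)]; exact hpos _

lemma lintegral_DD_polar {f : ℂ → ℝ≥0∞} (hf : Measurable f) :
    ∫⁻ v : DD, f v = ∫⁻ r in Ioo (0:ℝ) 1, ENNReal.ofReal r * ∫⁻ θ in Ioo (-Real.pi) Real.pi, f (circleMap 0 r θ) := by
  have hl : ∫⁻ v : DD, f v = ∫⁻ v in unitDisc, f v :=
    lintegral_subtype_comap measurableSet_unitDisc (μ := (volume : Measure ℂ)) f
  rw [hl, ← lintegral_indicator measurableSet_unitDisc, ← Complex.lintegral_comp_polarCoord_symm]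
  have ht : polarCoord.target = Ioi (0:ℝ) ×ˢ Ioo (-Real.pi) Real.pi := rfl
  have hp : ∀ p : ℝ × ℝ, Complex.polarCoord.symm p = circleMap 0 p.1 p.2 := by
    intro p
    rw [Complex.polarCoord_symm_apply, circleMap, zero_add, Complex.exp_mul_I]
    simp
  have hcm : Measurable (fun p : ℝ × ℝ => circleMap 0 p.1 p.2) := by
    unfold circleMap; fun_prop
  rw [ht, Measure.volume_eq_prod, ← Measure.prod_restrict, lintegral_prod]
  · rw [← lintegral_indicator measurableSet_Ioi, ← lintegral_indicator measurableSet_Ioo]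
    refine lintegral_congr fun r => ?_
    by_cases h0 : 0 < r
    · by_cases h1 : r < 1
      · rw [indicator_of_mem (show r ∈ Ioi (0:ℝ) from h0), indicator_of_mem (show r ∈ Ioo (0:ℝ) 1 from ⟨h0, h1⟩),
          ← lintegral_const_mul]
        · refine lintegral_congr fun θ => ?_
          rw [hp, indicator_of_mem, smul_eq_mul]
          simp [mem_unitDisc_iff, abs_of_pos h0, h1]
        · exact hf.comp (by unfold circleMap; fun_prop)
      · rw [indicator_of_mem (show r ∈ Ioi (0:ℝ) from h0), indicator_of_notMem (fun h => h1 h.2)]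
        rw [lintegral_eq_zero_of_ae_eq_zero]
        refine ae_of_all _ fun θ => ?_
        change _ • _ = (0:ℝ≥0∞)
        rw [hp, indicator_of_notMem, smul_zero]
        simpa [mem_unitDisc_iff, abs_of_pos h0] using h1
    · rw [indicator_of_notMem (show r ∉ Ioi (0:ℝ) from h0), indicator_of_notMem (fun h => h0 h.1)]
  · simp_rw [hp]
    refine Measurable.aemeasurable ?_
    have := (hf.indicator measurableSet_unitDisc).comp hcm
    exact (measurable_fst.ennreal_ofReal).mul this

lemma mean0 {u : DD → ℝ} (hu : IsHarmonicDiscFun u) (hc : Continuous u) (hpos : ∀ z, 0 ≤ u z) :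
    ∫⁻ v : DD, ENNReal.ofReal (u v) = ENNReal.ofReal (u D0) * ∫⁻ _v : DD, 1 := by
  have h1 := lintegral_DD_polar (ext0_measurable hc).ennreal_ofReal
  have h2 := lintegral_DD_polar (f := fun _ => 1) measurable_const
  simp_rw [ext0_coe] at h1
  rw [h1, h2, ← lintegral_const_mul']
  · refine setLIntegral_congr_fun measurableSet_Ioo fun r hr => ?_
    rw [circle_mean hu hpos hr.1 hr.2]; ring
  · exact ENNReal.ofReal_ne_top

/-- the Berezin kernel (unnormalised) -/
def kk (z w : DD) : ℝ≥0∞ := ENNReal.ofReal ((‖1 - (starRingEnd ℂ) (z : ℂ) * w‖ ^ 4)⁻¹)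

lemma continuous_kk : Continuous (fun p : DD × DD => kk p.1 p.2) := by
  unfold kk
  refine ENNReal.continuous_ofReal.comp (Continuous.inv₀ (by fun_prop) ?_)
  intro p
  have := one_sub_conj_ne p.1.norm_lt p.2.norm_lt
  positivity

lemma kk_symm (z w : DD) : kk z w = kk w z := by
  unfold kk
  rw [← RCLike.norm_conj (K := ℂ)]
  simp [mul_comm]

lemma kk_pos (z w : DD) : kk z w ≠ 0 := by
  have := one_sub_conj_ne z.norm_lt w.norm_lt
  unfold kk
  rw [ne_eq, ENNReal.ofReal_eq_zero, not_le]
  positivity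

lemma kk_mob (α β : ℂ) (h : ‖α‖ ^ 2 - ‖β‖ ^ 2 = 1) (z w : DD) :
    kk z w = ENNReal.ofReal ((‖jden α β z‖ ^ 4)⁻¹) * (ENNReal.ofReal ((‖jden α β w‖ ^ 4)⁻¹) *
      kk (mobD α β h z) (mobD α β h w)) := by
  unfold kk
  rw [← ENNReal.ofReal_mul (by positivity), ← ENNReal.ofReal_mul (by positivity)]
  congr 1
  have h1 := norm_pos_iff.2 (jden_ne h z.norm_lt)
  have h2 := norm_pos_iff.2 (jden_ne h w.norm_lt)
  have h3 := norm_pos_iff.2 (one_sub_conj_ne z.norm_lt w.norm_lt)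
  change _ = _ * (_ * (‖1 - (starRingEnd ℂ) (mob α β z) * mob α β w‖ ^ 4)⁻¹)
  rw [mob_key h z.norm_lt w.norm_lt, norm_div, norm_mul, RCLike.norm_conj]
  field_simp

lemma exists_mob (z : DD) : ∃ (α β : ℂ) (h : ‖α‖ ^ 2 - ‖β‖ ^ 2 = 1), mobD α β h D0 = z := by
  have hz := z.norm_lt
  have hp : 0 < 1 - ‖(z:ℂ)‖ ^ 2 := by nlinarith [norm_nonneg (z:ℂ)]
  set t := (Real.sqrt (1 - ‖(z:ℂ)‖ ^ 2))⁻¹ with ht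
  have htp : 0 < t := by positivity
  have ht2 : t ^ 2 * (1 - ‖(z:ℂ)‖ ^ 2) = 1 := by
    rw [ht, inv_pow, Real.sq_sqrt hp.le, inv_mul_cancel₀ hp.ne']
  refine ⟨t, t * z, ?_, ?_⟩
  · rw [norm_mul, Complex.norm_real, Real.norm_eq_abs, abs_of_pos htp, ← ht2]; ring
  · apply Subtype.ext
    have : (t:ℂ) ≠ 0 := by exact_mod_cast htp.ne'
    simp [mobD, mob, jden, D0, this]

lemma mean_val {u : DD → ℝ} (hu : IsHarmonicDiscFun u) (hc : Continuous u) (hpos : ∀ z, 0 ≤ u z)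
    (z : DD) :
    ∫⁻ w : DD, ENNReal.ofReal (u w) * kk z w = ENNReal.ofReal (u z) * ∫⁻ w : DD, kk z w := by
  obtain ⟨α, β, h, rfl⟩ := exists_mob z
  have key : ∀ f : DD → ℝ≥0∞, Measurable f → ∫⁻ w, f w * kk (mobD α β h D0) w =
      ENNReal.ofReal (‖jden α β D0‖ ^ 4) * ∫⁻ v, f (mobD α β h v) := by
    intro f hf
    rw [← lintegral_mobD α β h, ← lintegral_const_mul']
    · refine lintegral_congr fun w => ?_
      have h1 := kk_mob α β h D0 w
      have h0 : kk D0 w = 1 := by simp [kk, D0]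
      rw [h0] at h1
      have hj := norm_pos_iff.2 (jden_ne h D0.norm_lt)
      have h2 : ENNReal.ofReal (‖jden α β D0‖ ^ 4) = ENNReal.ofReal (‖jden α β w‖ ^ 4)⁻¹ *
          kk (mobD α β h D0) (mobD α β h w) := by
        rw [← mul_one (ENNReal.ofReal (‖jden α β D0‖ ^ 4)), h1, ← mul_assoc,
          ← ENNReal.ofReal_mul (by positivity), mul_inv_cancel₀ (by positivity), ENNReal.ofReal_one, one_mul]
      rw [h2]; ring
    · exact ENNReal.ofReal_ne_top
  have hm := mean0 (hu.comp_mobD α β h) (hc.comp (continuous_mobD α β h)) (fun z => hpos _)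
  have k1 := key (fun w => ENNReal.ofReal (u w)) hc.measurable.ennreal_ofReal
  have k2 := key (fun w => 1) measurable_const
  simp only [one_mul] at k2
  rw [k1, k2, hm]
  ring

lemma lintegral_one_DD_lt : ∫⁻ _v : DD, (1:ℝ≥0∞) < ∞ := by
  have hl : ∫⁻ _v : DD, (1:ℝ≥0∞) = ∫⁻ _v in unitDisc, (1:ℝ≥0∞) :=
    lintegral_subtype_comap measurableSet_unitDisc (μ := (volume : Measure ℂ)) (fun _ => 1)
  rw [hl, setLIntegral_const, one_mul]
  exact measure_ball_lt_top

lemma kk_le {R : ℝ} (hR : R < 1) {z : DD} (hz : ‖(z:ℂ)‖ ≤ R) (w : DD) :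
    kk z w ≤ ENNReal.ofReal (((1 - R) ^ 4)⁻¹) := by
  unfold kk
  apply ENNReal.ofReal_le_ofReal
  have h1 : 1 - R ≤ ‖1 - (starRingEnd ℂ) (z : ℂ) * w‖ := by
    have h2 := norm_sub_norm_le (1:ℂ) ((starRingEnd ℂ) (z : ℂ) * w)
    rw [norm_one, norm_mul, RCLike.norm_conj] at h2
    nlinarith [w.norm_lt, norm_nonneg (z:ℂ), norm_nonneg (w:ℂ)]
  have : 0 < 1 - R := by linarith
  gcongr

lemma lintegral_kk_lt (z : DD) : ∫⁻ w : DD, kk z w < ∞ := by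
  calc ∫⁻ w : DD, kk z w ≤ ∫⁻ _w : DD, ENNReal.ofReal (((1 - ‖(z:ℂ)‖) ^ 4)⁻¹) * 1 :=
        lintegral_mono fun w => by rw [mul_one]; exact kk_le z.norm_lt le_rfl w
    _ < ∞ := by
        rw [lintegral_const_mul' _ _ ENNReal.ofReal_ne_top]
        exact ENNReal.mul_lt_top ENNReal.ofReal_lt_top lintegral_one_DD_lt

instance : Measure.IsOpenPosMeasure (volume : Measure DD) := by
  constructor
  intro U hU hne h0
  have h1 : (volume : Measure DD) U = (volume : Measure ℂ) ((↑) '' U) :=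
    comap_subtype_coe_apply measurableSet_unitDisc volume U
  have h2 : IsOpen ((↑) '' U : Set ℂ) := isOpen_unitDisc.isOpenMap_subtype_val U hU
  rw [h1] at h0
  exact h2.measure_ne_zero volume (hne.image _) h0

/-- if a continuous nonnegative function has zero kernel integral it vanishes -/
lemma eq_zero_of_lintegral {u : DD → ℝ} (hc : Continuous u) (z : DD)
    (h : ∫⁻ w : DD, ENNReal.ofReal ((u w) ^ 2) * kk z w = 0) : ∀ w, u w = 0 := by
  have hk : Measurable (fun w => kk z w) := (continuous_kk.comp (Continuous.prodMk continuous_const continuous_id)).measurable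
  have hmeas : Measurable (fun w => ENNReal.ofReal ((u w) ^ 2) * kk z w) :=
    (hc.measurable.pow_const 2).ennreal_ofReal.mul hk
  rw [lintegral_eq_zero_iff hmeas] at h
  have h2 : u =ᵐ[volume] (fun _ => 0) := by
    filter_upwards [h] with w hw
    simp only [Pi.zero_apply, mul_eq_zero] at hw
    rcases hw with hw | hw
    · rw [ENNReal.ofReal_eq_zero] at hw
      nlinarith [sq_nonneg (u w)]
    · exact absurd hw (kk_pos _ _)
  intro w
  exact congrFun (Measure.eq_of_ae_eq h2 hc continuous_const) w

lemma max_principle {h : DD → ℝ} (hh : IsHarmonicDiscFun h) (hc : Continuous h) (z : DD)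
    (hle : ∀ w, h w ≤ h z) : ∀ w, h w = h z := by
  have hm := mean_val (hh.affine (-1) (h z)) (by fun_prop) (fun w => by linarith [hle w]) z
  have hk : Measurable (fun w => kk z w) := (continuous_kk.comp (Continuous.prodMk continuous_const continuous_id)).measurable
  have e0 : -1 * h z + h z = 0 := by ring
  rw [e0, ENNReal.ofReal_zero, zero_mul] at hm
  have : ∀ w, -1 * h w + h z = 0 := by
    have hs : ∀ w, 0 ≤ -1 * h w + h z := fun w => by linarith [hle w]
    intro w
    have := eq_zero_of_lintegral (u := fun w => Real.sqrt (-1 * h w + h z)) (by fun_prop) z (by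
      simp_rw [fun w => Real.sq_sqrt (hs w)]
      exact hm) w
    exact (Real.sqrt_eq_zero (hs w)).1 this
  intro w
  linarith [this w]


instance : IsFiniteMeasure (volume : Measure DD) := by
  constructor
  have := lintegral_one_DD_lt
  rwa [lintegral_one] at this

section act
variable {Γ : Type*} [Group Γ] {ρ : Γ → ℂ → ℂ} (hΓ : IsCocompactFuchsian Γ ρ)

def actD (hΓ : IsCocompactFuchsian Γ ρ) (γ : Γ) (z : DD) : DD := ⟨ρ γ z, hΓ.maps_disc γ z z.2⟩

lemma actD_one (z : DD) : actD hΓ 1 z = z := Subtype.ext (hΓ.one_act z z.2)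

lemma actD_mul (γ δ : Γ) (z : DD) : actD hΓ (γ * δ) z = actD hΓ γ (actD hΓ δ z) :=
  Subtype.ext (hΓ.mul_act γ δ z z.2)

lemma actD_inv (γ : Γ) (z : DD) : actD hΓ γ⁻¹ (actD hΓ γ z) = z := by
  rw [← actD_mul, inv_mul_cancel, actD_one]

lemma actD_inv' (γ : Γ) (z : DD) : actD hΓ γ (actD hΓ γ⁻¹ z) = z := by
  rw [← actD_mul, mul_inv_cancel, actD_one]

lemma actD_mob (γ : Γ) : ∃ (α β : ℂ) (h : ‖α‖ ^ 2 - ‖β‖ ^ 2 = 1), actD hΓ γ = mobD α β h := by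
  obtain ⟨α, β, h, hz⟩ := hΓ.moebius γ
  exact ⟨α, β, h, funext fun z => Subtype.ext (hz z z.2)⟩

lemma continuous_actD (γ : Γ) : Continuous (actD hΓ γ) := by
  obtain ⟨α, β, h, e⟩ := actD_mob hΓ γ
  rw [e]; exact continuous_mobD α β h

lemma exists_radius : ∃ R : ℝ, 0 < R ∧ R < 1 ∧ ∀ z : DD, ∃ γ : Γ, ‖(actD hΓ γ z : ℂ)‖ ≤ R := by
  obtain ⟨K, hK, hKc, hcov⟩ := hΓ.cocompact
  obtain ⟨γ0, h0⟩ := hcov 0 D0.2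
  obtain ⟨x, hx, hmax⟩ := hKc.exists_isMaxOn ⟨_, h0⟩ continuous_norm.continuousOn
  have hx1 := (mem_unitDisc_iff _).1 (hK hx)
  refine ⟨max ‖x‖ (1/2), by positivity, max_lt hx1 (by norm_num), fun z => ?_⟩
  obtain ⟨γ, hγ⟩ := hcov z z.2
  exact ⟨γ, le_max_of_le_left (hmax hγ)⟩

lemma finite_return {R : ℝ} (hR : R < 1) (z : DD) : {γ : Γ | ‖(actD hΓ γ z : ℂ)‖ ≤ R}.Finite := by
  refine (hΓ.properly_discontinuous (closedBall 0 (max R ‖(z:ℂ)‖)) ?_ (isCompact_closedBall _ _)).subset ?_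
  · exact closedBall_subset_ball (max_lt hR z.norm_lt)
  · intro γ hγ
    refine ⟨ρ γ z, ⟨z, by simp, rfl⟩, ?_⟩
    simp only [mem_closedBall, dist_zero_right]
    exact le_max_of_le_left hγ

lemma countable_group (hΓ : IsCocompactFuchsian Γ ρ) : Countable Γ := by
  have : (univ : Set Γ) ⊆ ⋃ n : ℕ, {γ : Γ | ‖(actD hΓ γ D0 : ℂ)‖ ≤ 1 - 1 / ((n:ℝ) + 1)} := by
    intro γ _
    have h := (actD hΓ γ D0).norm_lt
    obtain ⟨n, hn⟩ := exists_nat_one_div_lt (sub_pos.2 h)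
    exact mem_iUnion.2 ⟨n, by simp only [Set.mem_ofPred_eq]; linarith⟩
  have hc : (univ : Set Γ).Countable := by
    refine Set.Countable.mono this (countable_iUnion fun n => (finite_return hΓ ?_ D0).countable)
    have : 0 < 1 / ((n:ℝ) + 1) := by positivity
    linarith
  exact countable_univ_iff.1 hc

lemma lintegral_invariant (γ : Γ) (H : DD → DD → ℝ≥0∞) :
    ∫⁻ z, ∫⁻ w, kk z w * H (actD hΓ γ z) (actD hΓ γ w) = ∫⁻ z, ∫⁻ w, kk z w * H z w := by
  obtain ⟨α, β, h, e⟩ := actD_mob hΓ γ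
  rw [e, ← lintegral_mobD α β h (fun z => ∫⁻ w, kk z w * H z w)]
  refine lintegral_congr fun z => ?_
  rw [← lintegral_mobD α β h (fun w => kk (mobD α β h z) w * H (mobD α β h z) w), ← lintegral_const_mul' _ _ ENNReal.ofReal_ne_top]
  refine lintegral_congr fun w => ?_
  rw [kk_mob α β h z w]
  ring

lemma exists_cutoff : ∃ (R : ℝ) (χ : DD → ℝ≥0∞), 0 < R ∧ R < 1 ∧ Measurable χ ∧ (∀ z, χ z ≤ 1) ∧
    (∀ z : DD, ‖(z:ℂ)‖ ≤ R → χ z ≠ 0) ∧ (∀ z : DD, R < ‖(z:ℂ)‖ → χ z = 0) ∧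
    (∀ z, ∑' γ : Γ, χ (actD hΓ γ z) = 1) := by
  classical
  obtain ⟨R, hR0, hR1, hcov⟩ := exists_radius hΓ
  have := countable_group hΓ
  set K : Set DD := {z | ‖(z:ℂ)‖ ≤ R} with hK
  have hKm : MeasurableSet K := (isClosed_le (by fun_prop) continuous_const).measurableSet
  set I : DD → ℝ≥0∞ := K.indicator (fun _ => 1) with hI
  have hIm : Measurable I := measurable_const.indicator hKm
  set N : DD → ℝ≥0∞ := fun z => ∑' γ : Γ, I (actD hΓ γ z) with hN
  have hNm : Measurable N := Measurable.tsum fun γ => hIm.comp (continuous_actD hΓ γ).measurable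
  have hNinv : ∀ γ z, N (actD hΓ γ z) = N z := by
    intro γ z
    simp only [hN, ← actD_mul]
    exact (Equiv.mulRight γ).tsum_eq (fun δ => I (actD hΓ δ z))
  have hNge : ∀ z, 1 ≤ N z := by
    intro z
    obtain ⟨γ, hγ⟩ := hcov z
    calc 1 = I (actD hΓ γ z) := by rw [hI, indicator_of_mem]; exact hγ
      _ ≤ N z := ENNReal.le_tsum γ
  have hNtop : ∀ z, N z ≠ ∞ := by
    intro z
    have hf := finite_return hΓ hR1 z
    have : N z = ∑ γ ∈ hf.toFinset, I (actD hΓ γ z) := by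
      refine tsum_eq_sum fun γ hγ => ?_
      rw [hI, indicator_of_notMem]
      intro h'
      exact hγ (hf.mem_toFinset.2 h')
    rw [this]
    refine (ENNReal.sum_lt_top.2 fun γ _ => ?_).ne
    refine lt_of_le_of_lt (indicator_le_self' (fun _ _ => zero_le) _) ENNReal.one_lt_top
  refine ⟨R, fun z => I z / N z, hR0, hR1, hIm.div hNm, ?_, ?_, ?_, ?_⟩
  · intro z
    refine ENNReal.div_le_of_le_mul ?_
    rw [one_mul]
    exact le_trans (indicator_le_self' (fun _ _ => zero_le) _) (hNge z)
  · intro z hz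
    change I z / N z ≠ 0
    rw [hI, indicator_of_mem (show z ∈ K from hz)]
    exact (ENNReal.div_pos one_ne_zero (hNtop z)).ne'
  · intro z hz
    change I z / N z = 0
    rw [hI, indicator_of_notMem (show z ∉ K from not_le.2 hz), ENNReal.zero_div]
  · intro z
    simp only [hNinv, div_eq_mul_inv]
    rw [ENNReal.tsum_mul_right]
    exact ENNReal.mul_inv_cancel (zero_lt_one.trans_le (hNge z)).ne' (hNtop z)

lemma unfolding {χ : DD → ℝ≥0∞} (hχ : Measurable χ) (hsum : ∀ z, ∑' γ : Γ, χ (actD hΓ γ z) = 1)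
    {q : DD → DD → ℝ≥0∞} (hq : Measurable (Function.uncurry q))
    (hinv : ∀ (γ : Γ) z w, q (actD hΓ γ z) (actD hΓ γ w) = q z w) :
    ∫⁻ z, ∫⁻ w, kk z w * (χ z * q z w) = ∫⁻ z, ∫⁻ w, kk z w * (χ z * q w z) := by
  have := countable_group hΓ
  have hkm : Measurable (fun p : DD × DD => kk p.1 p.2) := continuous_kk.measurable
  have hact : ∀ γ, Measurable (actD hΓ γ) := fun γ => (continuous_actD hΓ γ).measurable
  have hm : ∀ γ : Γ, Measurable (fun p : DD × DD => kk p.1 p.2 * (χ p.1 * χ (actD hΓ γ p.2) * q p.1 p.2)) := by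
    intro γ
    exact hkm.mul (((hχ.comp measurable_fst).mul (hχ.comp ((hact γ).comp measurable_snd))).mul hq)
  have hm' : ∀ γ : Γ, Measurable (fun p : DD × DD => kk p.1 p.2 * (χ (actD hΓ γ⁻¹ p.1) * χ p.2 * q p.1 p.2)) := by
    intro γ
    exact hkm.mul (((hχ.comp ((hact _).comp measurable_fst)).mul (hχ.comp measurable_snd)).mul hq)
  calc ∫⁻ z, ∫⁻ w, kk z w * (χ z * q z w)
      = ∫⁻ z, ∫⁻ w, ∑' γ : Γ, kk z w * (χ z * χ (actD hΓ γ w) * q z w) := by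
        refine lintegral_congr fun z => lintegral_congr fun w => ?_
        rw [ENNReal.tsum_mul_left, ENNReal.tsum_mul_right, ENNReal.tsum_mul_left, hsum, mul_one]
    _ = ∑' γ : Γ, ∫⁻ z, ∫⁻ w, kk z w * (χ z * χ (actD hΓ γ w) * q z w) := by
        rw [← lintegral_tsum]
        · refine lintegral_congr fun z => ?_
          rw [lintegral_tsum]
          intro γ
          exact ((hm γ).comp measurable_prodMk_left).aemeasurable
        · intro γ
          exact (hm γ).lintegral_prod_right'.aemeasurable
    _ = ∑' γ : Γ, ∫⁻ z, ∫⁻ w, kk z w * (χ (actD hΓ γ⁻¹ z) * χ w * q z w) := by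
        refine tsum_congr fun γ => ?_
        rw [← lintegral_invariant hΓ γ (fun z w => χ (actD hΓ γ⁻¹ z) * χ w * q z w)]
        simp only [actD_inv, hinv]
    _ = ∫⁻ z, ∫⁻ w, ∑' γ : Γ, kk z w * (χ (actD hΓ γ⁻¹ z) * χ w * q z w) := by
        rw [← lintegral_tsum]
        · refine lintegral_congr fun z => ?_
          rw [lintegral_tsum]
          intro γ
          exact ((hm' γ).comp measurable_prodMk_left).aemeasurable
        · intro γ
          exact (hm' γ).lintegral_prod_right'.aemeasurable
    _ = ∫⁻ z, ∫⁻ w, kk z w * (χ w * q z w) := by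
        refine lintegral_congr fun z => lintegral_congr fun w => ?_
        rw [ENNReal.tsum_mul_left, ENNReal.tsum_mul_right, ENNReal.tsum_mul_right]
        have : ∑' γ : Γ, χ (actD hΓ γ⁻¹ z) = 1 := by
          rw [← hsum z]
          exact (Equiv.inv Γ).tsum_eq (fun γ => χ (actD hΓ γ z))
        rw [this, one_mul]
    _ = ∫⁻ w, ∫⁻ z, kk z w * (χ w * q z w) := by
        refine lintegral_lintegral_swap ?_
        exact (hkm.mul ((hχ.comp measurable_snd).mul hq)).aemeasurable
    _ = _ := by
        refine lintegral_congr fun z => lintegral_congr fun w => ?_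
        rw [kk_symm]
end act


def ex (a b : ℝ) (g : ℝ → ℝ) (s : ℝ) : ℝ := sInf {x | x ∈ Icc a b ∧ (s < g x ∨ x = b)}

section ex
variable {a b : ℝ} (hab : a < b) {g : ℝ → ℝ} {s : ℝ}

lemma ex_bdd : BddBelow {x | x ∈ Icc a b ∧ (s < g x ∨ x = b)} := ⟨a, fun _ hx => hx.1.1⟩

lemma ex_nonempty (hab : a < b) : {x | x ∈ Icc a b ∧ (s < g x ∨ x = b)}.Nonempty :=
  ⟨b, ⟨hab.le, le_rfl⟩, Or.inr rfl⟩

lemma ex_lt_iff (hab : a < b) {c : ℝ} : ex a b g s < c ↔ ∃ x ∈ Icc a b, (s < g x ∨ x = b) ∧ x < c := by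
  unfold ex
  rw [csInf_lt_iff ex_bdd (ex_nonempty hab)]
  constructor
  · rintro ⟨x, ⟨h1, h2⟩, h3⟩; exact ⟨x, h1, h2, h3⟩
  · rintro ⟨x, h1, h2, h3⟩; exact ⟨x, ⟨h1, h2⟩, h3⟩

lemma ex_mem_Icc (hab : a < b) : ex a b g s ∈ Icc a b :=
  ⟨le_csInf (ex_nonempty hab) fun _ hx => hx.1.1, csInf_le ex_bdd ⟨⟨hab.le, le_rfl⟩, Or.inr rfl⟩⟩

lemma le_of_lt_ex {x : ℝ} (hx : a ≤ x) (hxb : x ≤ b) (h : x < ex a b g s) : g x ≤ s := by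
  by_contra hc
  exact absurd (csInf_le ex_bdd (show x ∈ {x | x ∈ Icc a b ∧ (s < g x ∨ x = b)} from
    ⟨⟨hx, hxb⟩, Or.inl (not_le.1 hc)⟩)) (not_le.2 h)

lemma ex_val (hab : a < b) (hg : Continuous g) (ga : g a = 0) (gb : g b = 1) (h0 : 0 < s) (h1 : s < 1) :
    g (ex a b g s) = s := by
  have hm := ex_mem_Icc (g := g) (s := s) hab
  apply le_antisymm
  · by_contra hc
    push Not at hc
    have hne : a ≠ ex a b g s := by
      intro h; rw [← h, ga] at hc; linarith
    have hlt := lt_of_le_of_ne hm.1 hne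
    have e1 : ∀ᶠ x in nhdsWithin (ex a b g s) (Iio (ex a b g s)), s < g x :=
      (hg.continuousAt.eventually (lt_mem_nhds hc)).filter_mono nhdsWithin_le_nhds
    have e2 : ∀ᶠ x in nhdsWithin (ex a b g s) (Iio (ex a b g s)), a < x :=
      (lt_mem_nhds hlt).filter_mono nhdsWithin_le_nhds
    obtain ⟨x, ⟨hx1, hx2⟩, hx3⟩ := ((e1.and e2).and self_mem_nhdsWithin).exists
    have hx3' : x < ex a b g s := hx3
    exact absurd (le_of_lt_ex hx2.le (hx3'.le.trans hm.2) hx3') (not_le.2 hx1)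
  · have hcl := csInf_mem_closure (ex_nonempty (g := g) (s := s) hab) ex_bdd
    have hsub : closure {x | x ∈ Icc a b ∧ (s < g x ∨ x = b)} ⊆ {x | s ≤ g x} := by
      refine closure_minimal ?_ (isClosed_le continuous_const hg)
      rintro x ⟨_, h | h⟩
      · exact h.le
      · change s ≤ g x
        rw [h, gb]; exact h1.le
    exact hsub hcl

lemma ex_mem (hab : a < b) (hg : Continuous g) (ga : g a = 0) (gb : g b = 1) (h0 : 0 < s) (h1 : s < 1) :
    ex a b g s ∈ Ioo a b := by
  have hm := ex_mem_Icc (g := g) (s := s) hab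
  have hv := ex_val hab hg ga gb h0 h1
  refine ⟨lt_of_le_of_ne hm.1 ?_, lt_of_le_of_ne hm.2 ?_⟩
  · intro h; rw [← h, ga] at hv; linarith
  · intro h; rw [h, gb] at hv; linarith

lemma le_of_le_ex (hab : a < b) (hg : Continuous g) (ga : g a = 0) (gb : g b = 1) (h0 : 0 < s) (h1 : s < 1)
    {x : ℝ} (hx : a ≤ x) (h : x ≤ ex a b g s) : g x ≤ s := by
  rcases h.lt_or_eq with h | h
  · exact le_of_lt_ex hx (h.le.trans (ex_mem_Icc hab).2) h
  · rw [h, ex_val hab hg ga gb h0 h1]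
end ex

lemma measurable_ex {a b : ℝ} (hab : a < b) {G : DD → ℝ → ℝ}
    (hG : Continuous (fun p : DD × ℝ => G p.1 p.2)) :
    Measurable (fun p : DD × ℝ => ex a b (G p.1) p.2) := by
  refine measurable_of_Iio fun c => ?_
  by_cases hc : b < c
  · convert MeasurableSet.univ
    refine eq_univ_of_forall fun p => ?_
    exact lt_of_le_of_lt (ex_mem_Icc hab).2 hc
  · have : (fun p : DD × ℝ => ex a b (G p.1) p.2) ⁻¹' Iio c =
        ⋃ x ∈ Icc a b ∩ Iio c, {p : DD × ℝ | p.2 < G p.1 x} := by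
      ext p
      simp only [mem_preimage, mem_Iio, ex_lt_iff hab, mem_iUnion]
      constructor
      · rintro ⟨x, h1, h2 | h2, h3⟩
        · exact ⟨x, ⟨h1, h3⟩, h2⟩
        · exact absurd (h2 ▸ h3) hc
      · rintro ⟨x, ⟨h1, h3⟩, h2⟩
        exact ⟨x, h1, Or.inl h2, h3⟩
    rw [this]
    refine (isOpen_biUnion fun x _ => ?_).measurableSet
    exact isOpen_lt continuous_snd (hG.comp (continuous_fst.prodMk continuous_const))

lemma phi_int {s τ : ℝ} (hs : 0 ≤ s) (h0 : 0 ≤ τ) (h1 : τ ≤ 1) :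
    ENNReal.ofReal (2 * s * τ + τ ^ 2) =
      ∫⁻ t in Ioo (0:ℝ) 1, if t < τ then ENNReal.ofReal (2 * (s + t)) else 0 := by
  have e1 : (fun t : ℝ => if t < τ then ENNReal.ofReal (2 * (s + t)) else 0) =
      (Iio τ).indicator (fun t => ENNReal.ofReal (2 * (s + t))) := by
    ext t; simp [indicator]
  rw [e1, lintegral_indicator measurableSet_Iio, Measure.restrict_restrict measurableSet_Iio]
  have e2 : Iio τ ∩ Ioo 0 1 = Ioo 0 τ := by
    ext t; simp only [mem_inter_iff, mem_Iio, mem_Ioo]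
    constructor
    · rintro ⟨h, h', _⟩; exact ⟨h', h⟩
    · rintro ⟨h, h'⟩; exact ⟨h', h, h'.trans_le h1⟩
  rw [e2, ← ofReal_integral_eq_lintegral_ofReal]
  · rw [← integral_Ioc_eq_integral_Ioo, ← intervalIntegral.integral_of_le h0]
    congr 1
    rw [intervalIntegral.integral_const_mul, intervalIntegral.integral_add (by simp) (by simp)]
    simp
    ring
  · exact ((Continuous.integrableOn_Icc (by fun_prop)) : IntegrableOn (fun t : ℝ => 2 * (s + t)) (Icc 0 τ) volume).mono_set Ioo_subset_Icc_self
  · filter_upwards [ae_restrict_mem measurableSet_Ioo] with t ht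
    have := ht.1
    simp only [Pi.zero_apply]
    linarith

lemma sq_int : 3 * ∫⁻ s in Ioo (0:ℝ) 1, ENNReal.ofReal (s ^ 2) = 1 := by
  rw [← ofReal_integral_eq_lintegral_ofReal]
  · rw [← integral_Ioc_eq_integral_Ioo, ← intervalIntegral.integral_of_le zero_le_one, integral_pow,
      show (3 : ℝ≥0∞) = ENNReal.ofReal 3 by simp, ← ENNReal.ofReal_mul (by norm_num)]
    norm_num
  · exact ((Continuous.integrableOn_Icc (by fun_prop)) : IntegrableOn (fun t : ℝ => t ^ 2) (Icc 0 1) volume).mono_set Ioo_subset_Icc_self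
  · filter_upwards with t
    simp only [Pi.zero_apply]
    positivity

lemma young_int {τ τ' : ℝ → ℝ} (hτ : Measurable τ) (hτ' : Measurable τ')
    (h : ∀ s ∈ Ioo (0:ℝ) 1, τ s ∈ Icc (0:ℝ) 1) (h' : ∀ s ∈ Ioo (0:ℝ) 1, τ' s ∈ Icc (0:ℝ) 1)
    (hd : ∀ s ∈ Ioo (0:ℝ) 1, ∀ t ∈ Ioo (0:ℝ) 1, ¬ (t < τ s ∧ s < τ' t)) :
    (∫⁻ s in Ioo (0:ℝ) 1, ENNReal.ofReal (2 * s * τ s + τ s ^ 2)) +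
      (∫⁻ s in Ioo (0:ℝ) 1, ENNReal.ofReal (2 * s * τ' s + τ' s ^ 2)) ≤ 2 := by
  have e1 : (∫⁻ s in Ioo (0:ℝ) 1, ENNReal.ofReal (2 * s * τ s + τ s ^ 2)) =
      ∫⁻ s in Ioo (0:ℝ) 1, ∫⁻ t in Ioo (0:ℝ) 1, if t < τ s then ENNReal.ofReal (2 * (s + t)) else 0 :=
    setLIntegral_congr_fun measurableSet_Ioo fun s hs => phi_int hs.1.le (h s hs).1 (h s hs).2
  have e2 : (∫⁻ s in Ioo (0:ℝ) 1, ENNReal.ofReal (2 * s * τ' s + τ' s ^ 2)) =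
      ∫⁻ t in Ioo (0:ℝ) 1, ∫⁻ s in Ioo (0:ℝ) 1, if s < τ' t then ENNReal.ofReal (2 * (t + s)) else 0 :=
    setLIntegral_congr_fun measurableSet_Ioo fun s hs => phi_int hs.1.le (h' s hs).1 (h' s hs).2
  have m1 : Measurable (fun p : ℝ × ℝ => if p.2 < τ p.1 then ENNReal.ofReal (2 * (p.1 + p.2)) else 0) :=
    Measurable.ite (measurableSet_lt measurable_snd (hτ.comp measurable_fst)) (by fun_prop) measurable_const
  have m2 : Measurable (fun p : ℝ × ℝ => if p.2 < τ' p.1 then ENNReal.ofReal (2 * (p.1 + p.2)) else 0) :=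
    Measurable.ite (measurableSet_lt measurable_snd (hτ'.comp measurable_fst)) (by fun_prop) measurable_const
  rw [e1, e2, lintegral_lintegral_swap (f := fun t s => if s < τ' t then ENNReal.ofReal (2 * (t + s)) else 0) m2.aemeasurable,
    ← lintegral_add_left m1.lintegral_prod_right']
  have e3 : ∫⁻ s in Ioo (0:ℝ) 1, ∫⁻ t in Ioo (0:ℝ) 1, ENNReal.ofReal (2 * (s + t)) = 2 := by
    have : ∀ s ∈ Ioo (0:ℝ) 1, ∫⁻ t in Ioo (0:ℝ) 1, ENNReal.ofReal (2 * (s + t)) = 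
        (if s < 1 then ENNReal.ofReal (2 * (1/2 + s)) else 0) := by
      intro s hs
      rw [if_pos hs.2, show 2 * (1 / 2 + s) = 2 * s * 1 + 1 ^ 2 by ring, phi_int hs.1.le zero_le_one le_rfl]
      exact setLIntegral_congr_fun measurableSet_Ioo fun t ht => by simp [ht.2]
    rw [setLIntegral_congr_fun measurableSet_Ioo this, ← phi_int (by norm_num) zero_le_one le_rfl]
    norm_num
  rw [← e3]
  refine setLIntegral_mono' measurableSet_Ioo fun s hs => ?_
  have m3 : Measurable (fun t : ℝ => if t < τ s then ENNReal.ofReal (2 * (s + t)) else 0) :=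
    m1.comp measurable_prodMk_left
  dsimp only
  rw [← lintegral_add_left m3]
  refine setLIntegral_mono' measurableSet_Ioo fun t ht => ?_
  have := hd s hs t ht
  rw [add_comm t s]
  by_cases c1 : t < τ s
  · by_cases c2 : s < τ' t
    · exact absurd ⟨c1, c2⟩ this
    · simp [c1, c2]
  · by_cases c2 : s < τ' t <;> simp [c1, c2]


section core
variable {Γ : Type*} [Group Γ] {ρ : Γ → ℂ → ℂ}

lemma ex_equiv (hΓ : IsCocompactFuchsian Γ ρ) {a b : ℝ} (hab : a < b) {G : DD → ℝ → ℝ}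
    (hG : Continuous (fun p : DD × ℝ => G p.1 p.2))
    (ga : ∀ z, G z a = 0) (gb : ∀ z, G z b = 1)
    {φ : Γ → ℝ → ℝ} (hφ : ∀ γ, ∀ x ∈ Ioo a b, φ γ x ∈ Ioo a b)
    (hmono : ∀ γ, MonotoneOn (φ γ) (Ioo a b))
    (hinv : ∀ γ, ∀ x ∈ Ioo a b, φ γ (φ γ⁻¹ x) = x)
    (heq : ∀ γ z, ∀ x ∈ Ioo a b, G (actD hΓ γ z) (φ γ x) = G z x)
    {s : ℝ} (h0 : 0 < s) (h1 : s < 1) (γ : Γ) (z : DD) :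
    ex a b (G (actD hΓ γ z)) s = φ γ (ex a b (G z) s) := by
  have hc : ∀ z, Continuous (G z) := fun z => hG.comp (continuous_const.prodMk continuous_id)
  have hmem : ∀ z, ex a b (G z) s ∈ Ioo a b := fun z => ex_mem hab (hc z) (ga z) (gb z) h0 h1
  have key : ∀ γ z, φ γ (ex a b (G z) s) ≤ ex a b (G (actD hΓ γ z)) s := by
    intro γ z
    by_contra hcon
    push Not at hcon
    obtain ⟨y, hy, hy1, hy2⟩ := (ex_lt_iff hab).1 hcon
    have hyb : y < b := hy2.trans (hφ γ _ (hmem z)).2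
    have hsy : s < G (actD hΓ γ z) y := hy1.resolve_right hyb.ne
    have hay : a < y := by
      refine lt_of_le_of_ne hy.1 ?_
      intro h; rw [← h, ga] at hsy; linarith
    have hyI : y ∈ Ioo a b := ⟨hay, hyb⟩
    have hx := hφ γ⁻¹ y hyI
    have e := heq γ z _ hx
    rw [hinv γ y hyI] at e
    have : ex a b (G z) s ≤ φ γ⁻¹ y := by
      by_contra hh
      push Not at hh
      have := le_of_le_ex hab (hc z) (ga z) (gb z) h0 h1 hx.1.le hh.le
      linarith
    have := hmono γ (hmem z) hx this
    rw [hinv γ y hyI] at this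
    linarith
  apply le_antisymm _ (key γ z)
  have h2 := key γ⁻¹ (actD hΓ γ z)
  rw [actD_inv] at h2
  have h3 := hmono γ (hφ _ _ (hmem _)) (hmem z) h2
  rwa [hinv γ _ (hmem _)] at h3

lemma meas_left {α β δ : Type*} [MeasurableSpace α] [MeasurableSpace β] [MeasurableSpace δ]
    {f : α × β → δ} (hf : Measurable f) (x : α) : Measurable (fun y => f (x, y)) :=
  hf.comp measurable_prodMk_left

lemma meas_comp {α β δ : Type*} [MeasurableSpace α] [MeasurableSpace β] [MeasurableSpace δ]
    {f : α → δ} (hf : Measurable f) (g : β → α) (hg : Measurable g) : Measurable (fun y => f (g y)) :=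
  hf.comp hg

attribute [local irreducible] kk

set_option maxHeartbeats 1000000 in
theorem coreB (hΓ : IsCocompactFuchsian Γ ρ) {τ : DD → DD → ℝ → ℝ}
    (hτm : Measurable (fun p : (DD × DD) × ℝ => τ p.1.1 p.1.2 p.2))
    (hτ01 : ∀ z w, ∀ s ∈ Ioo (0:ℝ) 1, τ z w s ∈ Icc (0:ℝ) 1)
    (hyoung : ∀ z w, ∀ s ∈ Ioo (0:ℝ) 1, ∀ t ∈ Ioo (0:ℝ) 1, ¬ (t < τ z w s ∧ s < τ w z t))
    (hτc : ∀ z, ∀ s ∈ Ioo (0:ℝ) 1, Continuous (fun w => τ z w s))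
    (hharm : ∀ z, ∀ s ∈ Ioo (0:ℝ) 1, IsHarmonicDiscFun (fun w => τ z w s))
    (hτv : ∀ z, ∀ s ∈ Ioo (0:ℝ) 1, τ z z s = s)
    (hτinv : ∀ (γ : Γ) z w, ∀ s ∈ Ioo (0:ℝ) 1, τ (actD hΓ γ z) (actD hΓ γ w) s = τ z w s) :
    ∃ z, ∃ s ∈ Ioo (0:ℝ) 1, ∀ w, τ z w s = s := by
  have hτs : ∀ z w, Measurable (τ z w) := fun z w =>
    meas_left hτm (z, w)
  set Φ : DD → DD → ℝ → ℝ≥0∞ := fun z w s => ENNReal.ofReal (2 * s * τ z w s + τ z w s ^ 2) with hΦ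
  have hΦm : Measurable (fun p : (DD × DD) × ℝ => Φ p.1.1 p.1.2 p.2) :=
    (((measurable_snd.const_mul 2).mul hτm).add (hτm.pow_const 2)).ennreal_ofReal
  set Ψ : DD → DD → ℝ → ℝ≥0∞ := fun z w s => ENNReal.ofReal ((τ z w s - s) ^ 2) with hΨ
  have hΨm : Measurable (fun p : (DD × DD) × ℝ => Ψ p.1.1 p.1.2 p.2) :=
    ((hτm.sub measurable_snd).pow_const 2).ennreal_ofReal
  set q : DD → DD → ℝ≥0∞ := fun z w => ∫⁻ s in Ioo (0:ℝ) 1, Φ z w s with hq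
  have hqm : Measurable (Function.uncurry q) := hΦm.lintegral_prod_right'
  have hqinv : ∀ (γ : Γ) z w, q (actD hΓ γ z) (actD hΓ γ w) = q z w := by
    intro γ z w
    refine setLIntegral_congr_fun measurableSet_Ioo fun s hs => ?_
    have e := hτinv γ z w s hs
    simp only [hΦ, e]
  have hqy : ∀ z w, q z w + q w z ≤ 2 := fun z w =>
    young_int (hτs z w) (hτs w z) (hτ01 z w) (hτ01 w z) (hyoung z w)
  obtain ⟨R, χ, hR0, hR1, hχm, hχ1, hχpos, hχ0, hsum⟩ := exists_cutoff hΓ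
  have hunf := unfolding hΓ hχm hsum hqm hqinv
  have hkm : Measurable (fun p : DD × DD => kk p.1 p.2) := continuous_kk.measurable
  have hkz : ∀ z, Measurable (fun w => kk z w) := fun z =>
    Measurable.comp (f := fun w : DD => (z, w)) hkm (measurable_const.prodMk measurable_id)
  set c : DD → ℝ≥0∞ := fun z => ∫⁻ w, kk z w with hcdef
  have hcm : Measurable c := hkm.lintegral_prod_right'
  have mχc : Measurable (fun z => χ z * c z) := hχm.mul hcm
  set C : ℝ≥0∞ := ∫⁻ z, χ z * c z with hC
  have hCfin : C ≠ ∞ := by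
    have hle : C ≤ ∫⁻ z : DD, ENNReal.ofReal (((1-R)^4)⁻¹) * volume (univ : Set DD) := by
      refine lintegral_mono fun z => ?_
      by_cases hz : ‖(z:ℂ)‖ ≤ R
      · calc χ z * c z ≤ 1 * c z := by gcongr; exact hχ1 z
          _ = ∫⁻ w, kk z w := by rw [one_mul]
          _ ≤ ∫⁻ w : DD, ENNReal.ofReal (((1-R)^4)⁻¹) := lintegral_mono fun w => kk_le hR1 hz w
          _ = _ := by rw [lintegral_const]
      · rw [hχ0 z (not_le.1 hz), zero_mul]; exact zero_le
    refine (lt_of_le_of_lt hle ?_).ne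
    rw [lintegral_const]
    exact ENNReal.mul_lt_top (ENNReal.mul_lt_top ENNReal.ofReal_lt_top (measure_lt_top _ _)) (measure_lt_top _ _)
  set A : ℝ≥0∞ := ∫⁻ z, ∫⁻ w, kk z w * (χ z * q z w) with hA
  have hAC : A ≤ C := by
    have h2 : 2 * A ≤ 2 * C := by
      rw [two_mul]
      nth_rewrite 2 [hunf]
      have mA : Measurable (fun p : DD × DD => kk p.1 p.2 * (χ p.1 * q p.1 p.2)) :=
        hkm.mul ((hχm.comp measurable_fst).mul hqm)
      rw [hA, ← lintegral_add_left mA.lintegral_prod_right', hC, ← lintegral_const_mul _ mχc]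
      refine lintegral_mono fun z => ?_
      have mz : Measurable (fun w => kk z w * (χ z * q z w)) := meas_left mA z
      dsimp only
      rw [← lintegral_add_left mz, hcdef]
      dsimp only
      rw [← mul_assoc, ← lintegral_const_mul _ (hkz z)]
      refine lintegral_mono fun w => ?_
      calc kk z w * (χ z * q z w) + kk z w * (χ z * q w z) = kk z w * χ z * (q z w + q w z) := by ring
        _ ≤ kk z w * χ z * 2 := by gcongr; exact hqy z w
        _ = 2 * χ z * kk z w := by ring
    exact (ENNReal.mul_le_mul_iff_right (by norm_num) (by norm_num)).1 h2
  set k : ℝ≥0∞ := ∫⁻ s in Ioo (0:ℝ) 1, ENNReal.ofReal (s ^ 2) with hk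
  have hk3 : 3 * k = 1 := sq_int
  have hpt : ∀ z, ∀ s ∈ Ioo (0:ℝ) 1, (∫⁻ w, kk z w * Φ z w s) + ENNReal.ofReal (s^2) * c z =
      4 * ENNReal.ofReal (s^2) * c z + ∫⁻ w, kk z w * Ψ z w s := by
    intro z s hs
    have hcont : Continuous (fun w => τ z w s) := hτc z s hs
    have hm := mean_val (hharm z s hs) hcont (fun w => (hτ01 z w s hs).1) z
    have hm' : ∫⁻ w, kk z w * ENNReal.ofReal (4 * s * τ z w s) = 4 * ENNReal.ofReal (s^2) * c z := by
      have e : ∀ w, kk z w * ENNReal.ofReal (4 * s * τ z w s) =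
          ENNReal.ofReal (4 * s) * (ENNReal.ofReal (τ z w s) * kk z w) := by
        intro w
        rw [ENNReal.ofReal_mul (by linarith [hs.1])]; ring
      simp_rw [e]
      rw [lintegral_const_mul' _ _ ENNReal.ofReal_ne_top]
      have hm2 : ∫⁻ w, ENNReal.ofReal (τ z w s) * kk z w = ENNReal.ofReal s * c z := by
        have := hm
        rw [hτv z s hs] at this
        exact this
      rw [hm2, ← mul_assoc, ← ENNReal.ofReal_mul (by linarith [hs.1]),
        show (4 : ℝ≥0∞) = ENNReal.ofReal 4 by simp, ← ENNReal.ofReal_mul (by norm_num)]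
      congr 2; ring
    have mΦ : Measurable (fun w => kk z w * Φ z w s) :=
      (hkz z).mul (meas_comp hΦm (fun w : DD => ((z, w), s)) (by fun_prop))
    have mτ : Measurable (fun w => kk z w * ENNReal.ofReal (4 * s * τ z w s)) :=
      (hkz z).mul (hcont.measurable.const_mul _).ennreal_ofReal
    rw [← hm', hcdef]
    dsimp only
    rw [← lintegral_const_mul _ (hkz z), ← lintegral_add_left mΦ, ← lintegral_add_left mτ]
    refine lintegral_congr fun w => ?_
    have h0 := (hτ01 z w s hs).1
    have hs0 := hs.1.le
    rw [mul_comm (ENNReal.ofReal (s^2)), ← mul_add, ← mul_add, hΦ, hΨ]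
    dsimp only
    rw [← ENNReal.ofReal_add (by positivity) (by positivity), ← ENNReal.ofReal_add (by positivity) (by positivity)]
    congr 2; ring
  set W : ℝ≥0∞ := ∫⁻ z, χ z * ∫⁻ s in Ioo (0:ℝ) 1, ∫⁻ w, kk z w * Ψ z w s with hW
  have mΦ3 : Measurable (fun p : DD × (ℝ × DD) => kk p.1 p.2.2 * Φ p.1 p.2.2 p.2.1) := by
    have e1 : Measurable (fun p : DD × (ℝ × DD) => (p.1, p.2.2)) := by fun_prop
    exact (hkm.comp e1).mul (hΦm.comp (e1.prodMk (measurable_fst.comp measurable_snd)))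
  have mΨ3 : Measurable (fun p : DD × (ℝ × DD) => kk p.1 p.2.2 * Ψ p.1 p.2.2 p.2.1) := by
    have e1 : Measurable (fun p : DD × (ℝ × DD) => (p.1, p.2.2)) := by fun_prop
    exact (hkm.comp e1).mul (hΨm.comp (e1.prodMk (measurable_fst.comp measurable_snd)))
  have mΨ2 : Measurable (fun p : DD × ℝ => ∫⁻ w, kk p.1 w * Ψ p.1 w p.2) := by
    have : Measurable (fun p : (DD × ℝ) × DD => kk p.1.1 p.2 * Ψ p.1.1 p.2 p.1.2) :=
      meas_comp mΨ3 (fun p : (DD × ℝ) × DD => (p.1.1, (p.1.2, p.2))) (by fun_prop)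
    exact this.lintegral_prod_right'
  have mΦ2 : Measurable (fun p : DD × ℝ => ∫⁻ w, kk p.1 w * Φ p.1 w p.2) := by
    have : Measurable (fun p : (DD × ℝ) × DD => kk p.1.1 p.2 * Φ p.1.1 p.2 p.1.2) :=
      meas_comp mΦ3 (fun p : (DD × ℝ) × DD => (p.1.1, (p.1.2, p.2))) (by fun_prop)
    exact this.lintegral_prod_right'
  have hA' : A = ∫⁻ z, χ z * ∫⁻ s in Ioo (0:ℝ) 1, ∫⁻ w, kk z w * Φ z w s := by
    refine lintegral_congr fun z => ?_
    have mz : Measurable (fun p : ℝ × DD => kk z p.2 * Φ z p.2 p.1) := meas_left mΦ3 z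
    rw [lintegral_lintegral_swap (f := fun s w => kk z w * Φ z w s) mz.aemeasurable,
      ← lintegral_const_mul _ (show Measurable (fun w => ∫⁻ s in Ioo (0:ℝ) 1, kk z w * Φ z w s) from
        (mz.comp measurable_swap).lintegral_prod_right')]
    · refine lintegral_congr fun w => ?_
      rw [lintegral_const_mul _ (show Measurable (fun s => Φ z w s) from meas_left hΦm (z, w))]
      ring
  have mχΦ : Measurable (fun z => χ z * ∫⁻ s in Ioo (0:ℝ) 1, ∫⁻ w, kk z w * Φ z w s) :=
    hχm.mul mΦ2.lintegral_prod_right'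
  have mχΨ : Measurable (fun z => χ z * ∫⁻ s in Ioo (0:ℝ) 1, ∫⁻ w, kk z w * Ψ z w s) :=
    hχm.mul mΨ2.lintegral_prod_right'
  have mΦ1 : ∀ z, Measurable (fun s : ℝ => ∫⁻ w, kk z w * Φ z w s) := fun z => meas_left mΦ2 z
  have mΨ1 : ∀ z, Measurable (fun s : ℝ => ∫⁻ w, kk z w * Ψ z w s) := fun z => meas_left mΨ2 z
  have hid : A + k * C = 4 * k * C + W := by
    rw [hA', hC, ← lintegral_const_mul _ mχc, ← lintegral_const_mul _ mχc, hW,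
      ← lintegral_add_left mχΦ,
      ← lintegral_add_left (mχc.const_mul (4 * k))]
    refine lintegral_congr fun z => ?_
    have hz : (∫⁻ s in Ioo (0:ℝ) 1, ∫⁻ w, kk z w * Φ z w s) + k * c z =
        4 * k * c z + ∫⁻ s in Ioo (0:ℝ) 1, ∫⁻ w, kk z w * Ψ z w s := by
      have m0 : Measurable (fun s : ℝ => ENNReal.ofReal (s ^ 2)) := by fun_prop
      rw [hk, ← lintegral_mul_const _ m0, ← lintegral_const_mul _ m0, ← lintegral_mul_const _ (m0.const_mul _),
        ← lintegral_add_left (mΦ1 z), ← lintegral_add_left ((m0.const_mul _).mul_const _)]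
      exact setLIntegral_congr_fun measurableSet_Ioo fun s hs => hpt z s hs
    calc _ = χ z * ((∫⁻ s in Ioo (0:ℝ) 1, ∫⁻ w, kk z w * Φ z w s) + k * c z) := by
            ring
      _ = _ := by rw [hz]; ring
  have hW0 : W = 0 := by
    have h4 : 4 * k * C ≠ ∞ := by
      refine ENNReal.mul_ne_top (ENNReal.mul_ne_top (by norm_num) ?_) hCfin
      intro h; rw [h] at hk3; simp at hk3
    have h5 : 4 * k * C + W ≤ 4 * k * C + 0 := by
      rw [← hid, add_zero]
      calc A + k * C ≤ C + k * C := by gcongr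
        _ = (3 * k) * C + k * C := by rw [hk3, one_mul]
        _ = 4 * k * C := by ring
    exact le_antisymm ((ENNReal.add_le_add_iff_left h4).1 h5) zero_le
  rw [hW, lintegral_eq_zero_iff mχΨ] at hW0
  have hd := Measure.dense_of_ae hW0
  obtain ⟨z, hz1, hz2⟩ := hd.inter_open_nonempty {z : DD | ‖(z:ℂ)‖ < R}
    (isOpen_lt (by fun_prop) continuous_const) ⟨D0, by simpa [D0] using hR0⟩
  have hz3 : ∫⁻ s in Ioo (0:ℝ) 1, ∫⁻ w, kk z w * Ψ z w s = 0 := by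
    have : χ z * ∫⁻ s in Ioo (0:ℝ) 1, ∫⁻ w, kk z w * Ψ z w s = 0 := hz2
    exact (mul_eq_zero.1 this).resolve_left (hχpos z (le_of_lt hz1))
  rw [lintegral_eq_zero_iff (mΨ1 z)] at hz3
  have hz4 := (ae_restrict_iff' measurableSet_Ioo).1 hz3
  obtain ⟨s, hs1, hs2⟩ := (Measure.dense_of_ae hz4).inter_open_nonempty (Ioo 0 1) isOpen_Ioo (by simp)
  have hs3 : ∫⁻ w, kk z w * Ψ z w s = 0 := hs2 hs1
  have hcont : Continuous (fun w => τ z w s) := hτc z s hs1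
  have hfin := eq_zero_of_lintegral (u := fun w => τ z w s - s) (hcont.sub continuous_const) z (by
    rw [← hs3]; exact lintegral_congr fun w => mul_comm _ _)
  exact ⟨z, s, hs1, fun w => by linarith [hfin w]⟩

theorem coreA (hΓ : IsCocompactFuchsian Γ ρ) {a b : ℝ} (hab : a < b) {G : DD → ℝ → ℝ}
    (hG : Continuous (fun p : DD × ℝ => G p.1 p.2))
    (hharm : ∀ x, IsHarmonicDiscFun (fun z => G z x))
    (hG01 : ∀ z, ∀ x ∈ Icc a b, G z x ∈ Icc (0:ℝ) 1)
    (ga : ∀ z, G z a = 0) (gb : ∀ z, G z b = 1)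
    {φ : Γ → ℝ → ℝ} (hφ : ∀ γ, ∀ x ∈ Ioo a b, φ γ x ∈ Ioo a b)
    (hmono : ∀ γ, MonotoneOn (φ γ) (Ioo a b))
    (hinv : ∀ γ, ∀ x ∈ Ioo a b, φ γ (φ γ⁻¹ x) = x)
    (heq : ∀ γ z, ∀ x ∈ Ioo a b, G (actD hΓ γ z) (φ γ x) = G z x) :
    ∃ x ∈ Ioo a b, ∀ z w, G z x = G w x := by
  have hc : ∀ z, Continuous (G z) := fun z => hG.comp (continuous_const.prodMk continuous_id)
  set E : DD → ℝ → ℝ := fun z s => ex a b (G z) s with hE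
  have hEm : Measurable (fun p : DD × ℝ => E p.1 p.2) := measurable_ex hab hG
  have hEmem : ∀ z s, 0 < s → s < 1 → E z s ∈ Ioo a b :=
    fun z s h0 h1 => ex_mem hab (hc z) (ga z) (gb z) h0 h1
  have hEval : ∀ z s, 0 < s → s < 1 → G z (E z s) = s :=
    fun z s h0 h1 => ex_val hab (hc z) (ga z) (gb z) h0 h1
  set τ : DD → DD → ℝ → ℝ := fun z w s => G w (E z s) with hτ
  have hτm : Measurable (fun p : (DD × DD) × ℝ => τ p.1.1 p.1.2 p.2) := by
    have : Measurable (fun p : (DD × DD) × ℝ => ((p.1.2, E p.1.1 p.2) : DD × ℝ)) :=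
      (measurable_snd.comp measurable_fst).prodMk
        (hEm.comp ((measurable_fst.comp measurable_fst).prodMk measurable_snd))
    exact hG.measurable.comp this
  have hτ01 : ∀ z w, ∀ s ∈ Ioo (0:ℝ) 1, τ z w s ∈ Icc (0:ℝ) 1 := fun z w s _ =>
    hG01 w _ (ex_mem_Icc hab)
  have hyoung : ∀ z w, ∀ s ∈ Ioo (0:ℝ) 1, ∀ t ∈ Ioo (0:ℝ) 1, ¬ (t < τ z w s ∧ s < τ w z t) := by
    rintro z w s hs t ht ⟨h1, h2⟩
    rcases le_total (E z s) (E w t) with h | h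
    · have := le_of_le_ex hab (hc w) (ga w) (gb w) ht.1 ht.2 (hEmem z s hs.1 hs.2).1.le h
      exact absurd h1 (not_lt.2 this)
    · have := le_of_le_ex hab (hc z) (ga z) (gb z) hs.1 hs.2 (hEmem w t ht.1 ht.2).1.le h
      exact absurd h2 (not_lt.2 this)
  obtain ⟨z, s, hs, h⟩ := coreB hΓ hτm hτ01 hyoung
    (fun z s _ => hG.comp (continuous_id.prodMk continuous_const)) (fun z s _ => hharm _)
    (fun z s hs => hEval z s hs.1 hs.2) (by
      intro γ z w s hs
      simp only [hτ, hE]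
      rw [ex_equiv hΓ hab hG ga gb hφ hmono hinv heq hs.1 hs.2]
      exact heq γ w _ (hEmem z s hs.1 hs.2))
  exact ⟨E z s, hEmem z s hs.1 hs.2, fun w w' => (h w).trans (h w').symm⟩
end core


def cq (t : ℝ) : UnitCircle := ⟨(Circle.exp t : ℂ), by simp⟩

lemma cq_cont : Continuous cq := by
  unfold cq; fun_prop

lemma cq_eq_iff {s t : ℝ} : cq s = cq t ↔ Circle.exp s = Circle.exp t := by
  rw [Subtype.ext_iff]
  exact Circle.coe_inj

lemma cq_per (t : ℝ) : cq (t + 2 * Real.pi) = cq t := by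
  rw [cq_eq_iff]; exact Circle.periodic_exp t

def toCirc (p : UnitCircle) : Circle := ⟨p.1, p.2⟩

lemma toCirc_cont : Continuous toCirc := continuous_id

lemma cq_open : IsOpenMap cq := by
  intro U hU
  have h := isLocalHomeomorph_circleExp.isOpenMap U hU
  have : cq '' U = toCirc ⁻¹' (Circle.exp '' U) := by
    ext p
    simp only [mem_image, mem_preimage]
    constructor
    · rintro ⟨x, hx, rfl⟩; exact ⟨x, hx, rfl⟩
    · rintro ⟨x, hx, e⟩
      refine ⟨x, hx, Subtype.ext ?_⟩
      change ((Circle.exp x : Circle) : ℂ) = _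
      rw [e]; rfl
  rw [this]
  exact h.preimage toCirc_cont

lemma cq_inj {a b : ℝ} (hb : b ≤ a + 2 * Real.pi) {s t : ℝ} (hs : s ∈ Ioo a b) (ht : t ∈ Ioo a b)
    (h : cq s = cq t) : s = t := by
  rw [cq_eq_iff, Circle.exp_eq_exp] at h
  obtain ⟨m, hm⟩ := h
  have hp := Real.pi_pos
  have h1 : (m:ℝ) < 1 := by
    by_contra hc; push Not at hc
    nlinarith [hs.1, hs.2, ht.1, ht.2]
  have h2 : (-1:ℝ) < m := by
    by_contra hc; push Not at hc
    nlinarith [hs.1, hs.2, ht.1, ht.2]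
  have h1' : m < 1 := by exact_mod_cast h1
  have h2' : -1 < m := by exact_mod_cast h2
  have : m = 0 := by omega
  rw [hm, this]; simp

lemma cq_surj (c : ℝ) (p : UnitCircle) : ∃ t ∈ Ico c (c + 2 * Real.pi), cq t = p := by
  obtain ⟨t, ht⟩ : ∃ t : ℝ, cq t = p := by
    refine ⟨Complex.arg p.1, Subtype.ext ?_⟩
    have := Complex.norm_mul_exp_arg_mul_I p.1
    have hn : ‖p.1‖ = 1 := by simp
    rw [hn] at this
    simpa [cq, Circle.coe_exp] using this
  have hp : Function.Periodic cq (2 * Real.pi) := cq_per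
  obtain ⟨y, hy, e⟩ := hp.exists_mem_Ico (by positivity) t c
  exact ⟨y, hy, e ▸ ht⟩

lemma exists_nhd {O : Set UnitCircle} (hO : IsOpen O) {y : UnitCircle} (hy : y ∈ O) :
    ∃ V ⊆ O, IsOpen V ∧ IsPreconnected V ∧ y ∈ V := by
  obtain ⟨t, -, rfl⟩ := cq_surj 0 y
  obtain ⟨ε, hε, h⟩ := Metric.isOpen_iff.1 (hO.preimage cq_cont) t hy
  refine ⟨cq '' ball t ε, image_subset_iff.2 h, cq_open _ isOpen_ball, ?_, mem_image_of_mem _ (mem_ball_self hε)⟩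
  exact ((convex_ball t ε).isPreconnected).image _ cq_cont.continuousOn

section good
variable {Γ : Type*} [Group Γ] {ρ : Γ → ℂ → ℂ}

structure Good (hΓ : IsCocompactFuchsian Γ ρ) (σ : Γ → UnitCircle → UnitCircle) (F : UnitCircle → DD → ℝ) : Prop where
  act : IsActionByHomeomorphisms Γ UnitCircle σ
  cont : Continuous (fun p : UnitCircle × DD => F p.1 p.2)
  harm : ∀ x, IsHarmonicDiscFun (F x)
  equiv : ∀ γ x z, F (σ γ x) (actD hΓ γ z) = F x z

def Cst (F : UnitCircle → DD → ℝ) (p : UnitCircle) : Prop := ∀ z w, F p z = F p w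

variable {hΓ : IsCocompactFuchsian Γ ρ} {σ : Γ → UnitCircle → UnitCircle} {F : UnitCircle → DD → ℝ}

lemma Good.neg (h : Good hΓ σ F) : Good hΓ σ (fun p z => - F p z) where
  act := h.act
  cont := h.cont.neg
  harm x := by simpa using (h.harm x).affine (-1) 0
  equiv γ x z := by simp only [h.equiv]

lemma cst_neg {p : UnitCircle} : Cst (fun p z => - F p z) p ↔ Cst F p := by
  simp [Cst]

lemma Good.contz (h : Good hΓ σ F) (z : DD) : Continuous (fun p => F p z) :=
  h.cont.comp (continuous_id.prodMk continuous_const)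

lemma Good.contp (h : Good hΓ σ F) (p : UnitCircle) : Continuous (F p) :=
  h.cont.comp (continuous_const.prodMk continuous_id)

lemma Good.equiv' (h : Good hΓ σ F) (γ : Γ) (x : UnitCircle) (z : DD) :
    F (σ γ x) z = F x (actD hΓ γ⁻¹ z) := by
  rw [← h.equiv γ x, actD_inv']

lemma Good.inv_l (h : Good hΓ σ F) (γ : Γ) (x : UnitCircle) : σ γ⁻¹ (σ γ x) = x := by
  rw [← h.act.mul_act, inv_mul_cancel, h.act.one_act]

lemma Good.inv_r (h : Good hΓ σ F) (γ : Γ) (x : UnitCircle) : σ γ (σ γ⁻¹ x) = x := by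
  rw [← h.act.mul_act, mul_inv_cancel, h.act.one_act]

lemma Good.cst_act (h : Good hΓ σ F) (γ : Γ) {p : UnitCircle} (hp : Cst F p) : Cst F (σ γ p) := by
  intro z w
  rw [h.equiv', h.equiv']; exact hp _ _

lemma Good.cst_act' (h : Good hΓ σ F) (γ : Γ) {p : UnitCircle} (hp : Cst F (σ γ p)) : Cst F p := by
  have := h.cst_act γ⁻¹ hp
  rwa [h.inv_l] at this

lemma Good.closed_cst (h : Good hΓ σ F) : IsClosed {p | Cst F p} := by
  have : {p | Cst F p} = ⋂ z, ⋂ w, {p | F p z = F p w} := by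
    ext p; simp [Cst]
  rw [this]
  exact isClosed_iInter fun z => isClosed_iInter fun w => isClosed_eq (h.contz z) (h.contz w)

lemma compact_ballD {R : ℝ} (hR : R < 1) : IsCompact {z : DD | ‖(z:ℂ)‖ ≤ R} := by
  rw [Subtype.isCompact_iff]
  convert isCompact_closedBall (0:ℂ) R
  ext x
  simp only [mem_image, mem_closedBall, dist_zero_right]
  constructor
  · rintro ⟨z, hz, rfl⟩; exact hz
  · intro hx
    exact ⟨⟨x, (mem_unitDisc_iff _).2 (lt_of_le_of_lt hx hR)⟩, hx, rfl⟩

lemma Good.exists_max (h : Good hΓ σ F) {Y : Set UnitCircle} (hY : IsClosed Y) (hne : Y.Nonempty)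
    (hinv : ∀ γ, ∀ y ∈ Y, σ γ y ∈ Y) : ∃ y ∈ Y, Cst F y ∧ ∀ p ∈ Y, ∀ z, F p z ≤ F y D0 := by
  obtain ⟨R, hR0, hR1, hcov⟩ := exists_radius hΓ
  have hc : IsCompact (Y ×ˢ {z : DD | ‖(z:ℂ)‖ ≤ R}) := hY.isCompact.prod (compact_ballD hR1)
  obtain ⟨y0, hy0⟩ := hne
  obtain ⟨⟨y, z0⟩, ⟨hy, hz0⟩, hmax⟩ := hc.exists_isMaxOn ⟨(y0, D0), hy0, by simpa [D0] using hR0.le⟩ h.cont.continuousOn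
  have hle : ∀ p ∈ Y, ∀ z, F p z ≤ F y z0 := by
    intro p hp z
    obtain ⟨γ, hγ⟩ := hcov z
    rw [← h.equiv γ]
    exact hmax (show (σ γ p, actD hΓ γ z) ∈ Y ×ˢ {z : DD | ‖(z:ℂ)‖ ≤ R} from ⟨hinv γ p hp, hγ⟩)
  have hcst := max_principle (h.harm y) (h.contp y) z0 (hle y hy)
  refine ⟨y, hy, fun z w => by rw [hcst z, hcst w], fun p hp z => ?_⟩
  rw [hcst D0]; exact hle p hp z

structure Gap (F : UnitCircle → DD → ℝ) (a b : ℝ) : Prop where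
  lt : a < b
  le : b ≤ a + 2 * Real.pi
  ca : Cst F (cq a)
  cb : Cst F (cq b)
  nc : ∀ x ∈ Ioo a b, ¬ Cst F (cq x)

lemma Gap.neg {a b : ℝ} (h : Gap F a b) : Gap (fun p z => - F p z) a b :=
  ⟨h.lt, h.le, cst_neg.2 h.ca, cst_neg.2 h.cb, fun x hx hc => h.nc x hx (cst_neg.1 hc)⟩

lemma Good.exists_gap (h : Good hΓ σ F) {θ : ℝ} (hθ : ¬ Cst F (cq θ)) : ∃ a b, Gap F a b := by
  obtain ⟨p, -, hp, -⟩ := h.exists_max isClosed_univ ⟨cq 0, mem_univ _⟩ (fun _ _ _ => mem_univ _)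
  set T : Set ℝ := {t | Cst F (cq t)} with hT
  have hTc : IsClosed T := h.closed_cst.preimage cq_cont
  have hpi := Real.pi_pos
  obtain ⟨t1, ht1, e1⟩ := cq_surj (θ - 2 * Real.pi) p
  obtain ⟨t2, ht2, e2⟩ := cq_surj θ p
  have hA : (T ∩ Iic θ).Nonempty := ⟨t1, by simpa [hT, e1] using hp, by have := ht1.2; simp only [mem_Iic]; linarith⟩
  have hB : (T ∩ Ici θ).Nonempty := ⟨t2, by simpa [hT, e2] using hp, ht2.1⟩
  have bA : BddAbove (T ∩ Iic θ) := ⟨θ, fun _ hx => hx.2⟩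
  have bB : BddBelow (T ∩ Ici θ) := ⟨θ, fun _ hx => hx.2⟩
  have ma := (hTc.inter isClosed_Iic).csSup_mem hA bA
  have mb := (hTc.inter isClosed_Ici).csInf_mem hB bB
  set a := sSup (T ∩ Iic θ)
  set b := sInf (T ∩ Ici θ)
  have ha : a < θ := lt_of_le_of_ne ma.2 (fun e => hθ (e ▸ ma.1))
  have hb : θ < b := lt_of_le_of_ne mb.2 (fun e => hθ (e ▸ mb.1))
  have haT : a + 2 * Real.pi ∈ T := by
    change Cst F (cq (a + 2 * Real.pi))
    rw [cq_per]; exact ma.1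
  refine ⟨a, b, ha.trans hb, ?_, ma.1, mb.1, ?_⟩
  · refine csInf_le bB ⟨haT, ?_⟩
    by_contra hc
    have hc' : a + 2 * Real.pi ≤ θ := (not_le.1 (show ¬ θ ≤ a + 2 * Real.pi from hc)).le
    have := le_csSup bA (show a + 2 * Real.pi ∈ T ∩ Iic θ from ⟨haT, hc'⟩)
    change a + 2 * Real.pi ≤ a at this
    linarith
  · intro x hx hc
    rcases le_total x θ with hl | hl
    · exact absurd (le_csSup bA (show x ∈ T ∩ Iic θ from ⟨hc, hl⟩)) (not_le.2 hx.1)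
    · exact absurd (csInf_le bB (show x ∈ T ∩ Ici θ from ⟨hc, hl⟩)) (not_le.2 hx.2)
end good


section gap
variable {Γ : Type*} [Group Γ] {ρ : Γ → ℂ → ℂ}
variable {hΓ : IsCocompactFuchsian Γ ρ} {σ : Γ → UnitCircle → UnitCircle} {F : UnitCircle → DD → ℝ}
  {a b : ℝ}

def arc (σ : Γ → UnitCircle → UnitCircle) (a b : ℝ) (γ : Γ) : Set UnitCircle := σ γ '' (cq '' Ioo a b)

def PP (F : UnitCircle → DD → ℝ) (a b : ℝ) : Set UnitCircle :=
  {y | Cst F y ∧ (F y D0 = F (cq a) D0 ∨ F y D0 = F (cq b) D0)}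

lemma Good.arc_open (h : Good hΓ σ F) (γ : Γ) : IsOpen (arc σ a b γ) := by
  have : arc σ a b γ = (σ γ⁻¹) ⁻¹' (cq '' Ioo a b) := by
    ext y
    constructor
    · rintro ⟨x, hx, rfl⟩
      rw [mem_preimage, h.inv_l]; exact hx
    · intro hy
      exact ⟨_, hy, h.inv_r γ y⟩
  rw [this]
  exact (cq_open _ isOpen_Ioo).preimage (h.act.continuous_act _)

lemma Good.arc_conn (h : Good hΓ σ F) (γ : Γ) : IsPreconnected (arc σ a b γ) :=
  (isPreconnected_Ioo.image _ cq_cont.continuousOn).image _ (h.act.continuous_act γ).continuousOn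

lemma Good.arc_nc (h : Good hΓ σ F) (g : Gap F a b) {γ : Γ} {y : UnitCircle} (hy : y ∈ arc σ a b γ) :
    ¬ Cst F y := by
  obtain ⟨_, ⟨x, hx, rfl⟩, rfl⟩ := hy
  exact fun hc => g.nc x hx (h.cst_act' γ hc)

lemma Good.arc_act (h : Good hΓ σ F) {γ : Γ} {y : UnitCircle} (hy : y ∈ arc σ a b γ) (δ : Γ) :
    σ δ y ∈ arc σ a b (δ * γ) := by
  obtain ⟨x, hx, rfl⟩ := hy
  exact ⟨x, hx, h.act.mul_act _ _ _⟩

lemma Good.PP_act (h : Good hΓ σ F) {y : UnitCircle} (hy : y ∈ PP F a b) (δ : Γ) : σ δ y ∈ PP F a b := by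
  refine ⟨h.cst_act δ hy.1, ?_⟩
  rw [h.equiv', hy.1 _ D0]; exact hy.2

lemma Good.PP_closed (h : Good hΓ σ F) : IsClosed (PP F a b) := by
  have : PP F a b = {y | Cst F y} ∩ ({y | F y D0 = F (cq a) D0} ∪ {y | F y D0 = F (cq b) D0}) := rfl
  rw [this]
  exact h.closed_cst.inter ((isClosed_eq (h.contz _) continuous_const).union (isClosed_eq (h.contz _) continuous_const))

lemma Good.arc_closure (h : Good hΓ σ F) (g : Gap F a b) (γ : Γ) :
    closure (arc σ a b γ) ⊆ arc σ a b γ ∪ PP F a b := by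
  have hc : IsCompact (σ γ '' (cq '' Icc a b)) :=
    (isCompact_Icc.image cq_cont).image (h.act.continuous_act γ)
  have h1 : closure (arc σ a b γ) ⊆ σ γ '' (cq '' Icc a b) :=
    closure_minimal (image_mono (image_mono Ioo_subset_Icc_self)) hc.isClosed
  refine h1.trans ?_
  rintro _ ⟨_, ⟨x, hx, rfl⟩, rfl⟩
  rcases eq_or_lt_of_le hx.1 with e | e
  · subst e; exact Or.inr (h.PP_act ⟨g.ca, Or.inl rfl⟩ γ)
  rcases eq_or_lt_of_le hx.2 with e' | e'
  · subst e'; exact Or.inr (h.PP_act ⟨g.cb, Or.inr rfl⟩ γ)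
  exact Or.inl ⟨_, ⟨x, ⟨e, e'⟩, rfl⟩, rfl⟩

lemma Good.sub_of_meet (h : Good hΓ σ F) (g : Gap F a b) (γ : Γ) {C : Set UnitCircle}
    (hC : IsPreconnected C) (hP : ∀ y ∈ C, y ∉ PP F a b) (hm : (C ∩ arc σ a b γ).Nonempty) :
    C ⊆ arc σ a b γ := by
  refine hC.subset_of_closure_inter_subset (h.arc_open γ) hm ?_
  rintro y ⟨hy1, hy2⟩
  exact (h.arc_closure g γ hy1).resolve_right (hP y hy2)

lemma Good.closure_N (h : Good hΓ σ F) (g : Gap F a b) :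
    closure (⋃ γ, arc σ a b γ) ⊆ (⋃ γ, arc σ a b γ) ∪ PP F a b := by
  intro y hy
  by_contra hc
  rw [mem_union, not_or] at hc
  obtain ⟨V, hV, hVo, hVc, hyV⟩ := exists_nhd (h.PP_closed (a := a) (b := b)).isOpen_compl hc.2
  obtain ⟨x, hxV, hxN⟩ := mem_closure_iff.1 hy V hVo hyV
  obtain ⟨γ, hγ⟩ := mem_iUnion.1 hxN
  exact hc.1 (mem_iUnion.2 ⟨γ, h.sub_of_meet g γ hVc (fun y hy => hV hy) ⟨x, hxV, hγ⟩ hyV⟩)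

lemma Good.upper (h : Good hΓ σ F) (g : Gap F a b) {x : ℝ} (hx : x ∈ Ioo a b) (z : DD) :
    F (cq x) z ≤ max (F (cq a) D0) (F (cq b) D0) := by
  have hx' : cq x ∈ closure (⋃ γ, arc σ a b γ) :=
    subset_closure (mem_iUnion.2 ⟨1, _, ⟨x, hx, rfl⟩, h.act.one_act _⟩)
  obtain ⟨y, hy, hcst, hmax⟩ := h.exists_max (Y := closure (⋃ γ, arc σ a b γ)) isClosed_closure ⟨_, hx'⟩ (by
    intro γ y hy
    refine map_mem_closure (h.act.continuous_act γ) hy ?_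
    intro p hp
    obtain ⟨δ, hδ⟩ := mem_iUnion.1 hp
    exact mem_iUnion.2 ⟨_, h.arc_act hδ γ⟩)
  refine (hmax _ hx' z).trans ?_
  rcases h.closure_N g hy with hN | hP
  · obtain ⟨γ, hγ⟩ := mem_iUnion.1 hN
    exact absurd hcst (h.arc_nc g hγ)
  · rcases hP.2 with e | e <;> rw [e]
    · exact le_max_left _ _
    · exact le_max_right _ _

lemma Good.lower (h : Good hΓ σ F) (g : Gap F a b) {x : ℝ} (hx : x ∈ Ioo a b) (z : DD) :
    min (F (cq a) D0) (F (cq b) D0) ≤ F (cq x) z := by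
  have := h.neg.upper g.neg hx z
  rw [max_neg_neg] at this
  linarith

lemma Good.ends_ne (h : Good hΓ σ F) (g : Gap F a b) : F (cq a) D0 ≠ F (cq b) D0 := by
  intro e
  obtain ⟨x, hx⟩ := nonempty_Ioo.2 g.lt
  refine g.nc x hx fun z w => ?_
  have h1 := h.upper g hx z
  have h2 := h.lower g hx z
  have h3 := h.upper g hx w
  have h4 := h.lower g hx w
  rw [e, max_self] at h1 h3
  rw [e, min_self] at h2 h4
  linarith

lemma Good.finite_orbit (h : Good hΓ σ F) (g : Gap F a b) (hlt : F (cq a) D0 < F (cq b) D0) :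
    ∃ t : Finset Γ, ∀ γ, ∃ δ ∈ t, arc σ a b γ = arc σ a b δ := by
  set m := (F (cq a) D0 + F (cq b) D0) / 2 with hm
  set W := closure (⋃ γ, arc σ a b γ) ∩ {y | F y D0 = m} with hW
  have hWc : IsCompact W := (isClosed_closure.inter (isClosed_eq (h.contz _) continuous_const)).isCompact
  have hWN : W ⊆ ⋃ γ, arc σ a b γ := by
    rintro y ⟨hy, hy'⟩
    refine (h.closure_N g hy).resolve_right ?_
    rintro ⟨-, e | e⟩ <;> rw [mem_ofPred_eq, e] at hy' <;> linarith
  obtain ⟨t, ht⟩ := hWc.elim_finite_subcover _ (fun γ => h.arc_open γ) hWN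
  refine ⟨t, fun γ => ?_⟩
  have hcont : ContinuousOn (fun x => F (σ γ (cq x)) D0) (Icc a b) :=
    ((h.contz D0).comp ((h.act.continuous_act γ).comp cq_cont)).continuousOn
  have va : F (σ γ (cq a)) D0 = F (cq a) D0 := by rw [h.equiv']; exact g.ca _ _
  have vb : F (σ γ (cq b)) D0 = F (cq b) D0 := by rw [h.equiv']; exact g.cb _ _
  obtain ⟨x, hx, hxm⟩ := intermediate_value_Icc g.lt.le hcont
    (show m ∈ Icc (F (σ γ (cq a)) D0) (F (σ γ (cq b)) D0) by rw [va, vb]; constructor <;> linarith)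
  have hxm' : F (σ γ (cq x)) D0 = m := hxm
  have hx' : x ∈ Ioo a b := by
    refine ⟨lt_of_le_of_ne hx.1 ?_, lt_of_le_of_ne hx.2 ?_⟩
    · rintro rfl; rw [va] at hxm'; linarith
    · rintro rfl; rw [vb] at hxm'; linarith
  have hy : σ γ (cq x) ∈ arc σ a b γ := ⟨_, ⟨x, hx', rfl⟩, rfl⟩
  have hyW : σ γ (cq x) ∈ W := ⟨subset_closure (mem_iUnion.2 ⟨γ, hy⟩), hxm'⟩
  have := ht hyW
  simp only [mem_iUnion] at this
  obtain ⟨δ, hδ, hyδ⟩ := this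
  refine ⟨δ, hδ, Subset.antisymm ?_ ?_⟩
  · exact h.sub_of_meet g δ (h.arc_conn γ) (fun y hy hP => h.arc_nc g hy hP.1) ⟨_, hy, hyδ⟩
  · exact h.sub_of_meet g γ (h.arc_conn δ) (fun y hy hP => h.arc_nc g hy hP.1) ⟨_, hyδ, hy⟩

def stab (hσ : IsActionByHomeomorphisms Γ UnitCircle σ) (I : Set UnitCircle) : Subgroup Γ where
  carrier := {γ | σ γ '' I = I}
  one_mem' := by
    have : σ 1 = id := funext hσ.one_act
    simp [this]
  mul_mem' := by
    intro γ δ hγ hδ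
    have : σ (γ * δ) = σ γ ∘ σ δ := funext (hσ.mul_act γ δ)
    simp only [mem_ofPred_eq] at hγ hδ ⊢
    rw [this, image_comp, hδ, hγ]
  inv_mem' := by
    intro γ hγ
    simp only [mem_ofPred_eq] at hγ ⊢
    have e : σ γ⁻¹ ∘ σ γ = id := by
      funext x
      simp only [Function.comp_apply, id]
      rw [← hσ.mul_act, inv_mul_cancel, hσ.one_act]
    nth_rewrite 1 [← hγ]
    rw [← image_comp, e, image_id]

lemma Good.stab_fuchsian (h : Good hΓ σ F) (g : Gap F a b) (hlt : F (cq a) D0 < F (cq b) D0) :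
    IsCocompactFuchsian (stab h.act (cq '' Ioo a b)) (fun γ => ρ γ) where
  one_act := hΓ.one_act
  mul_act γ δ := hΓ.mul_act γ δ
  maps_disc γ := hΓ.maps_disc γ
  moebius γ := hΓ.moebius γ
  faithful γ hγ := Subtype.ext (hΓ.faithful γ hγ)
  properly_discontinuous K hK hKc :=
    Set.Finite.preimage (f := Subtype.val) Subtype.val_injective.injOn (hΓ.properly_discontinuous K hK hKc)
  cocompact := by
    obtain ⟨t, ht⟩ := h.finite_orbit g hlt
    obtain ⟨R, hR0, hR1, hcov⟩ := exists_radius hΓ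
    refine ⟨⋃ δ ∈ t, (Subtype.val : DD → ℂ) '' (actD hΓ δ⁻¹ '' {z : DD | ‖(z:ℂ)‖ ≤ R}), ?_, ?_, ?_⟩
    · refine iUnion₂_subset fun δ _ => ?_
      rintro _ ⟨z, -, rfl⟩
      exact z.2
    · exact t.isCompact_biUnion fun δ _ =>
        ((compact_ballD hR1).image (continuous_actD hΓ _)).image continuous_subtype_val
    · intro z hz
      obtain ⟨γ, hγ⟩ := hcov ⟨z, hz⟩
      obtain ⟨δ, hδ, e⟩ := ht γ
      have hmem : δ⁻¹ * γ ∈ stab h.act (cq '' Ioo a b) := by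
        change σ (δ⁻¹ * γ) '' (cq '' Ioo a b) = cq '' Ioo a b
        have e1 : σ (δ⁻¹ * γ) = σ δ⁻¹ ∘ σ γ := funext (h.act.mul_act _ _)
        have e2 : σ δ⁻¹ ∘ σ δ = id := funext (h.inv_l δ)
        have e3 : σ γ '' (cq '' Ioo a b) = σ δ '' (cq '' Ioo a b) := e
        rw [e1, image_comp, e3, ← image_comp, e2, image_id]
      refine ⟨⟨δ⁻¹ * γ, hmem⟩, mem_iUnion₂.2 ⟨δ, hδ, ?_⟩⟩
      refine ⟨_, ⟨actD hΓ γ ⟨z, hz⟩, hγ, rfl⟩, ?_⟩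
      rw [← actD_mul]
      rfl

lemma Good.gap_false_lt (h : Good hΓ σ F) (g : Gap F a b) (hlt : F (cq a) D0 < F (cq b) D0) : False := by
  set α := F (cq a) D0 with hα
  set β := F (cq b) D0 with hβ
  set Λ := stab h.act (cq '' Ioo a b) with hΛ
  have hF : IsCocompactFuchsian Λ (fun γ => ρ γ) := h.stab_fuchsian g hlt
  have hex : ∀ (γ : Λ) (x : ℝ), ∃ y, x ∈ Ioo a b → (y ∈ Ioo a b ∧ cq y = σ γ (cq x)) := by
    intro γ x
    by_cases hx : x ∈ Ioo a b
    · have e : σ γ '' (cq '' Ioo a b) = cq '' Ioo a b := γ.2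
      have : σ γ (cq x) ∈ cq '' Ioo a b := by
        rw [← e]; exact ⟨_, ⟨x, hx, rfl⟩, rfl⟩
      obtain ⟨y, hy, e'⟩ := this
      exact ⟨y, fun _ => ⟨hy, e'⟩⟩
    · exact ⟨0, fun h => absurd h hx⟩
  choose φ hφ using hex
  have hφm : ∀ γ, ∀ x ∈ Ioo a b, φ γ x ∈ Ioo a b := fun γ x hx => (hφ γ x hx).1
  have hφq : ∀ γ, ∀ x ∈ Ioo a b, cq (φ γ x) = σ γ (cq x) := fun γ x hx => (hφ γ x hx).2
  have hinv : ∀ γ, ∀ x ∈ Ioo a b, φ γ (φ γ⁻¹ x) = x := by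
    intro γ x hx
    refine cq_inj g.le (hφm _ _ (hφm _ _ hx)) hx ?_
    rw [hφq _ _ (hφm _ _ hx), hφq _ _ hx]
    exact h.inv_r _ _
  have hinv' : ∀ γ, ∀ x ∈ Ioo a b, φ γ⁻¹ (φ γ x) = x := by
    intro γ x hx
    have := hinv γ⁻¹ x hx
    rwa [inv_inv] at this
  have hcont : ∀ γ, ContinuousOn (φ γ) (Ioo a b) := by
    intro γ x hx
    rw [ContinuousWithinAt, _root_.tendsto_nhds]
    intro O hO hxO
    have hopen : IsOpen (cq '' (O ∩ Ioo a b)) := cq_open _ (hO.inter isOpen_Ioo)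
    have hmem : σ γ (cq x) ∈ cq '' (O ∩ Ioo a b) := by
      rw [← hφq γ x hx]; exact ⟨_, ⟨hxO, hφm γ x hx⟩, rfl⟩
    have hc : Continuous (fun x => σ γ (cq x)) := (h.act.continuous_act γ).comp cq_cont
    have hev := (hc.tendsto x).eventually (hopen.mem_nhds hmem)
    filter_upwards [hev.filter_mono nhdsWithin_le_nhds, self_mem_nhdsWithin] with x' h1 h2
    obtain ⟨o, ⟨ho1, ho2⟩, e⟩ := h1
    rw [← hφq γ x' h2] at e
    have := cq_inj g.le ho2 (hφm γ x' h2) e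
    change φ γ x' ∈ O
    rw [← this]; exact ho1
  have hinj : ∀ γ, InjOn (φ γ) (Ioo a b) := by
    intro γ x hx y hy e
    rw [← hinv' γ x hx, ← hinv' γ y hy, e]
  have hfc : ∀ z, Continuous (fun x => F (cq x) z) := fun z => (h.contz z).comp cq_cont
  have hmono : ∀ γ, MonotoneOn (φ γ) (Ioo a b) := by
    intro γ
    rcases (hcont γ).strictMonoOn_of_injOn_Ioo g.lt (hinj γ) with hm | hm
    · exact hm.monotoneOn
    exfalso
    set m := (α + β) / 2 with hmdef
    have e1 : ∀ᶠ x in nhdsWithin b (Iio b), m < F (cq x) D0 := by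
      refine (((hfc D0).tendsto b).eventually (lt_mem_nhds ?_)).filter_mono nhdsWithin_le_nhds
      change m < β
      linarith
    have e2 : ∀ᶠ x in nhdsWithin a (Ioi a), F (cq x) (actD hΓ (γ : Γ)⁻¹ D0) < m := by
      refine (((hfc _).tendsto a).eventually (gt_mem_nhds ?_)).filter_mono nhdsWithin_le_nhds
      rw [g.ca _ D0]
      change α < m
      linarith
    obtain ⟨l, hl, hsub⟩ := mem_nhdsLT_iff_exists_Ioo_subset.1 e1
    obtain ⟨y, hy⟩ := nonempty_Ioo.2 (max_lt (show l < b from hl) g.lt)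
    have hyI : y ∈ Ioo a b := ⟨(le_max_right _ _).trans_lt hy.1, hy.2⟩
    have hly : l < y := (le_max_left _ _).trans_lt hy.1
    have hx1 := hφm γ⁻¹ y hyI
    have e3 : ∀ᶠ x in nhdsWithin a (Ioi a), x < φ γ⁻¹ y := (gt_mem_nhds hx1.1).filter_mono nhdsWithin_le_nhds
    obtain ⟨x, ⟨hx2, hx3⟩, hx4⟩ := ((e2.and e3).and self_mem_nhdsWithin).exists
    have hxI : x ∈ Ioo a b := ⟨hx4, hx3.trans hx1.2⟩
    have h5 := hm hxI hx1 hx3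
    rw [hinv γ y hyI] at h5
    have h6 : m < F (cq (φ γ x)) D0 := hsub ⟨hly.trans h5, (hφm γ x hxI).2⟩
    rw [hφq γ x hxI, h.equiv'] at h6
    linarith
  have hpos : 0 < β - α := by linarith
  set c := (β - α)⁻¹ with hc
  have hcpos : 0 < c := inv_pos.2 hpos
  have hc1 : c * (β - α) = 1 := inv_mul_cancel₀ hpos.ne'
  have hga : ∀ z, c * F (cq a) z + (-(c * α)) = 0 := by
    intro z; rw [g.ca z D0]; change c * α + _ = 0; ring
  have hgb : ∀ z, c * F (cq b) z + (-(c * α)) = 1 := by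
    intro z; rw [g.cb z D0]; change c * β + _ = 1; linarith
  obtain ⟨x, hx, hcon⟩ := coreA hF g.lt (G := fun z x => c * F (cq x) z + (-(c * α)))
    (by
      have : Continuous (fun p : DD × ℝ => F (cq p.2) p.1) :=
        h.cont.comp ((cq_cont.comp continuous_snd).prodMk continuous_fst)
      exact (continuous_const.mul this).add continuous_const)
    (fun x => (h.harm (cq x)).affine _ _)
    (by
      intro z x hx
      rcases eq_or_lt_of_le hx.1 with e | e
      · subst e; rw [hga z]; simp
      rcases eq_or_lt_of_le hx.2 with e' | e'
      · subst e'; rw [hgb z]; simp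
      have h1 := h.upper g ⟨e, e'⟩ z
      have h2 := h.lower g ⟨e, e'⟩ z
      rw [max_eq_right hlt.le] at h1
      rw [min_eq_left hlt.le] at h2
      constructor
      · have := mul_le_mul_of_nonneg_left h2 hcpos.le
        change c * α ≤ _ at this
        linarith
      · have := mul_le_mul_of_nonneg_left h1 hcpos.le
        change _ ≤ c * β at this
        linarith)
    hga hgb hφm hmono hinv
    (by
      intro γ z x hx
      rw [hφq γ x hx]
      have : F (σ γ (cq x)) (actD hF γ z) = F (cq x) z := h.equiv γ (cq x) z
      rw [this])
  refine g.nc x hx fun z w => ?_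
  have := hcon z w
  have h3 : c * F (cq x) z = c * F (cq x) w := by linarith
  exact mul_left_cancel₀ hcpos.ne' h3

lemma Good.all_cst (h : Good hΓ σ F) (p : UnitCircle) : Cst F p := by
  by_contra hp
  obtain ⟨θ, -, rfl⟩ := cq_surj 0 p
  obtain ⟨a, b, g⟩ := h.exists_gap hp
  rcases lt_or_gt_of_ne (h.ends_ne g) with hl | hl
  · exact h.gap_false_lt g hl
  · exact h.neg.gap_false_lt g.neg (neg_lt_neg hl)
end gap

end helpers

/-- **Corollary 1.4 (X = S¹).** For a cocompact Fuchsian group `Γ` acting on `X₀` by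
`γ·h = h ∘ γ⁻¹` and on the circle by homeomorphisms, every continuous `Γ`-equivariant map
`F : S¹ → X₀` takes values in the constant functions. -/
theorem equivariant_maps_into_X0_are_constant_circle
    {Γ : Type*} [Group Γ] (ρ : Γ → ℂ → ℂ) (hΓ : IsCocompactFuchsian Γ ρ)
    (σ : Γ → UnitCircle → UnitCircle) (hσ : IsActionByHomeomorphisms Γ UnitCircle σ)
    (F : UnitCircle → C(↥unitDisc, ℝ))
    (hFcont : Continuous F)
    (hFX₀ : ∀ x : UnitCircle, F x ∈ X₀)
    (hFequiv : ∀ (γ : Γ) (x : UnitCircle) (z w : ↥unitDisc),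
      (w : ℂ) = ρ γ⁻¹ (z : ℂ) → F (σ γ x) z = F x w) :
    ∀ (x : UnitCircle) (z w : ↥unitDisc), F x z = F x w := by
  have hg : Good hΓ σ (fun p z => F p z) := by
    refine ⟨hσ, ?_, fun x => (hFX₀ x).1, fun γ x z => ?_⟩
    · have : LocallyCompactSpace ↥unitDisc := isOpen_unitDisc.locallyCompactSpace
      exact ContinuousEval.continuous_eval.comp ((hFcont.comp continuous_fst).prodMk continuous_snd)
    · refine hFequiv γ x (actD hΓ γ z) z ?_
      exact (congrArg Subtype.val (actD_inv hΓ γ z)).symm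
  exact fun x => hg.all_cst x
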